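/- arXiv:2501.00849 — 3 statements merged into one kernel-verified Lean document; each statement's English description precedes it below -/
import Mathlib

section
/- Let d ≥ 1, δ ≥ 0 and 1 < p⁻ ≤ p⁺ < ∞. There exists a constant c ≥ 1, depending only on d, p⁻, p⁺ and δ, such that for every exponent p ∈ [p⁻, p⁺] and all matrices A, B ∈ ℝ^{d×d}: c⁻¹ ((φ_p)_{|A^sym|})*(|S_p(A) − S_p(B)|) ≤ |F_p(A) − F_p(B)|² ≤ c ((φ_p)_{|A^sym|})*(|S_p(A) − S_p(B)|). -/
open MeasureTheory

/-- The shifted N-function `(φ_p)_a(r) = ∫₀^r (δ+a+s)^{p-2} s ds`. -/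
noncomputable def phiShift (δ p a r : ℝ) : ℝ :=
  ∫ s in (0:ℝ)..r, (δ + a + s) ^ (p - 2) * s

/-- The Fenchel conjugate `ψ*(r) = sup_{s ≥ 0} (r·s − ψ(s))`. -/
noncomputable def fconj (ψ : ℝ → ℝ) (r : ℝ) : ℝ :=
  ⨆ s : NNReal, (r * (s : ℝ) - ψ (s : ℝ))

/-- The symmetric part `A^sym := ½(A + Aᵀ)`. -/
noncomputable def msym {d : ℕ} (A : Matrix (Fin d) (Fin d) ℝ) : Matrix (Fin d) (Fin d) ℝ :=
  (2 : ℝ)⁻¹ • (A + A.transpose)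

/-- The Frobenius norm of a matrix. -/
noncomputable def frob {d : ℕ} (A : Matrix (Fin d) (Fin d) ℝ) : ℝ :=
  Real.sqrt (∑ i, ∑ j, (A i j) ^ 2)

/-- `S_p(A) := (δ+|A^sym|)^{p−2} A^sym`. -/
noncomputable def Smap {d : ℕ} (δ p : ℝ) (A : Matrix (Fin d) (Fin d) ℝ) :
    Matrix (Fin d) (Fin d) ℝ :=
  ((δ + frob (msym A)) ^ (p - 2)) • msym A

/-- `F_p(A) := (δ+|A^sym|)^{(p−2)/2} A^sym`. -/
noncomputable def Fmap {d : ℕ} (δ p : ℝ) (A : Matrix (Fin d) (Fin d) ℝ) :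
    Matrix (Fin d) (Fin d) ℝ :=
  ((δ + frob (msym A)) ^ ((p - 2) / 2)) • msym A

lemma abs_one_sub_rpow_mul_le {t q Q : ℝ} (ht : 0 < t) (ht1 : t ≤ 1) (hq : -1 ≤ q)
    (hqQ : q ≤ Q) (hQ : 1 ≤ Q) : |1 - t ^ q| * t ≤ Q * (1 - t) := by
  have h1 : 1 - t ≤ Q * (1 - t) := by nlinarith
  rcases le_total q 0 with h0 | h0
  · have h2 : 1 ≤ t ^ q := Real.one_le_rpow_of_pos_of_le_one_of_nonpos ht ht1 h0
    have h3 : t ^ q * t = t ^ (q + 1) := (Real.rpow_add_one ht.ne' q).symm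
    have h4 : t ^ (q + 1) ≤ 1 := Real.rpow_le_one ht.le ht1 (by linarith)
    rw [abs_of_nonpos (by linarith)]
    nlinarith
  · have h2 : t ^ q ≤ 1 := Real.rpow_le_one ht.le ht1 h0
    rw [abs_of_nonneg (by linarith)]
    have h5 : (1 - t ^ q) * t ≤ 1 - t ^ q := by nlinarith
    refine h5.trans ?_
    rcases le_total q 1 with h | h
    · have h3 : t ^ (1 : ℝ) ≤ t ^ q := Real.rpow_le_rpow_of_exponent_ge ht ht1 h
      rw [Real.rpow_one] at h3
      linarith
    · have h3 := one_add_mul_self_le_rpow_one_add (s := t - 1) (by linarith) h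
      rw [add_sub_cancel] at h3
      nlinarith

lemma abs_rpow_sub_rpow_mul_le {u v q Q : ℝ} (hv : 0 < v) (hvu : v ≤ u) (hq : -1 ≤ q)
    (hqQ : q ≤ Q) (hQ : 1 ≤ Q) : |u ^ q - v ^ q| * v ≤ Q * u ^ q * (u - v) := by
  have hu : 0 < u := hv.trans_le hvu
  obtain ⟨t, ht, ht1, rfl⟩ : ∃ t : ℝ, 0 < t ∧ t ≤ 1 ∧ v = t * u :=
    ⟨v / u, by positivity, (div_le_one hu).2 hvu, by field_simp⟩
  have hP : 0 < u ^ q := Real.rpow_pos_of_pos hu q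
  have h := abs_one_sub_rpow_mul_le ht ht1 hq hqQ hQ
  have e : u ^ q - (t * u) ^ q = u ^ q * (1 - t ^ q) := by
    rw [Real.mul_rpow ht.le hu.le]; ring
  rw [e, abs_mul, abs_of_pos hP]
  calc u ^ q * |1 - t ^ q| * (t * u) = u ^ q * u * (|1 - t ^ q| * t) := by ring
    _ ≤ u ^ q * u * (Q * (1 - t)) := by gcongr
    _ = _ := by ring

lemma mul_rpow_mul_sub_le {u v q : ℝ} (hv : 0 < v) (hvu : v ≤ u) (hq : -1 ≤ q) (hq0 : q ≤ 0) :
    (q + 1) * u ^ q * (u - v) ≤ u ^ q * u - v ^ q * v := by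
  have hu : 0 < u := hv.trans_le hvu
  obtain ⟨t, ht, ht1, rfl⟩ : ∃ t : ℝ, 0 < t ∧ t ≤ 1 ∧ v = t * u :=
    ⟨v / u, by positivity, (div_le_one hu).2 hvu, by field_simp⟩
  have hP : 0 < u ^ q := Real.rpow_pos_of_pos hu q
  have h3 := rpow_one_add_le_one_add_mul_self (s := t - 1) (by linarith)
    (p := q + 1) (by linarith) (by linarith)
  rw [add_sub_cancel, Real.rpow_add_one ht.ne'] at h3
  rw [Real.mul_rpow ht.le hu.le]
  have h4 : 0 ≤ u ^ q * u * (1 + (q + 1) * (t - 1) - t ^ q * t) :=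
    mul_nonneg (by positivity) (by linarith)
  linarith

section Quasinorm

variable {E : Type*} [NormedAddCommGroup E] [InnerProductSpace ℝ E]

lemma norm_rpow_smul_sub_le {δ q Q : ℝ} {x y : E} (hδ : 0 ≤ δ) (hq : -1 ≤ q) (hqQ : q ≤ Q)
    (hQ : 1 ≤ Q) (hyx : ‖y‖ ≤ ‖x‖) :
    ‖(δ + ‖x‖) ^ q • x - (δ + ‖y‖) ^ q • y‖ ≤ (1 + Q) * ((δ + ‖x‖) ^ q * ‖x - y‖) := by
  have hg : 0 ≤ (δ + ‖x‖) ^ q := by positivity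
  have h0 : 0 ≤ (δ + ‖x‖) ^ q * ‖x - y‖ := by positivity
  rcases eq_or_ne y 0 with rfl | hy
  · simp only [smul_zero, sub_zero, norm_smul, Real.norm_of_nonneg hg] at h0 ⊢
    nlinarith
  have hy' : 0 < ‖y‖ := norm_pos_iff.2 hy
  have h1 := abs_rpow_sub_rpow_mul_le (u := δ + ‖x‖) (v := δ + ‖y‖) (by linarith) (by linarith)
    hq hqQ hQ
  have h2 : ‖x‖ - ‖y‖ ≤ ‖x - y‖ := norm_sub_norm_le x y
  have e : (δ + ‖x‖) ^ q • x - (δ + ‖y‖) ^ q • y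
      = (δ + ‖x‖) ^ q • (x - y) + ((δ + ‖x‖) ^ q - (δ + ‖y‖) ^ q) • y := by module
  rw [e]
  refine (norm_add_le _ _).trans ?_
  rw [norm_smul, norm_smul, Real.norm_of_nonneg hg, Real.norm_eq_abs]
  have h3 : |(δ + ‖x‖) ^ q - (δ + ‖y‖) ^ q| * ‖y‖
      ≤ |(δ + ‖x‖) ^ q - (δ + ‖y‖) ^ q| * (δ + ‖y‖) := by gcongr; linarith
  have h4 : Q * (δ + ‖x‖) ^ q * (δ + ‖x‖ - (δ + ‖y‖)) ≤ Q * (δ + ‖x‖) ^ q * ‖x - y‖ := by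
    gcongr; linarith
  linarith

lemma le_norm_rpow_smul_sub {δ q μ : ℝ} {x y : E} (hδ : 0 ≤ δ) (hμ : 0 ≤ μ) (hμ1 : μ ≤ 1 / 2)
    (hq : μ - 1 ≤ q) (hyx : ‖y‖ ≤ ‖x‖) :
    μ * ((δ + ‖x‖) ^ q * ‖x - y‖) ≤ ‖(δ + ‖x‖) ^ q • x - (δ + ‖y‖) ^ q • y‖ := by
  have hg : 0 ≤ (δ + ‖x‖) ^ q := by positivity
  have h0 : 0 ≤ (δ + ‖x‖) ^ q * ‖x - y‖ := by positivity
  rcases eq_or_ne y 0 with rfl | hy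
  · simp only [smul_zero, sub_zero, norm_smul, Real.norm_of_nonneg hg] at h0 ⊢
    nlinarith
  have hy' : 0 < ‖y‖ := norm_pos_iff.2 hy
  have hg' : 0 ≤ (δ + ‖y‖) ^ q := by positivity
  have hin : inner ℝ x y ≤ ‖x‖ * ‖y‖ := real_inner_le_norm x y
  have hD : ‖x - y‖ ^ 2 = ‖x‖ ^ 2 - 2 * inner ℝ x y + ‖y‖ ^ 2 := norm_sub_sq_real x y
  rcases le_total 0 q with h | h
  · have hgg : (δ + ‖y‖) ^ q ≤ (δ + ‖x‖) ^ q := by gcongr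
    have hcs := real_inner_le_norm ((δ + ‖x‖) ^ q • x - (δ + ‖y‖) ^ q • y) (x - y)
    have e : inner ℝ ((δ + ‖x‖) ^ q • x - (δ + ‖y‖) ^ q • y) (x - y)
        = (δ + ‖x‖) ^ q * ‖x‖ ^ 2 + (δ + ‖y‖) ^ q * ‖y‖ ^ 2
          - ((δ + ‖x‖) ^ q + (δ + ‖y‖) ^ q) * inner ℝ x y := by
      simp only [inner_sub_left, inner_sub_right, real_inner_smul_left,
        real_inner_self_eq_norm_sq, real_inner_comm x y]
      ring
    rw [e] at hcs
    generalize (δ + ‖x‖) ^ q = g at *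
    generalize (δ + ‖y‖) ^ q = k at *
    generalize inner ℝ x y = i at *
    rcases (norm_nonneg (x - y)).eq_or_lt with hz | hz
    · rw [← hz]; simp
    refine le_of_mul_le_mul_right (le_trans ?_ hcs) hz
    have h5 : 0 ≤ (g - k) * (‖x‖ ^ 2 - ‖y‖ ^ 2) :=
      mul_nonneg (by linarith) (by nlinarith [norm_nonneg x])
    have h6 : 0 ≤ k * ‖x - y‖ ^ 2 := by positivity
    have h7 : 0 ≤ (1 / 2 - μ) * (g * ‖x - y‖ ^ 2) := mul_nonneg (by linarith) (by positivity)
    calc μ * (g * ‖x - y‖) * ‖x - y‖ = μ * (g * ‖x - y‖ ^ 2) := by ring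
      _ ≤ 1 / 2 * (g * ‖x - y‖ ^ 2) := by linarith
      _ ≤ 1 / 2 * ((g + k) * ‖x - y‖ ^ 2 + (g - k) * (‖x‖ ^ 2 - ‖y‖ ^ 2)) := by linarith
      _ = _ := by rw [hD]; ring
  · have hgg : (δ + ‖x‖) ^ q ≤ (δ + ‖y‖) ^ q :=
      Real.rpow_le_rpow_of_nonpos (by linarith) (by linarith) h
    have h1 := mul_rpow_mul_sub_le (u := δ + ‖x‖) (v := δ + ‖y‖) (by linarith) (by linarith)
      (by linarith) h
    have e : ‖(δ + ‖x‖) ^ q • x - (δ + ‖y‖) ^ q • y‖ ^ 2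
        = ((δ + ‖x‖) ^ q * ‖x‖ - (δ + ‖y‖) ^ q * ‖y‖) ^ 2
          + 2 * ((δ + ‖x‖) ^ q * (δ + ‖y‖) ^ q * (‖x‖ * ‖y‖ - inner ℝ x y)) := by
      rw [norm_sub_sq_real, norm_smul, norm_smul, Real.norm_of_nonneg hg,
        Real.norm_of_nonneg hg', real_inner_smul_left, real_inner_smul_right]
      ring
    refine le_of_sq_le_sq ?_ (norm_nonneg _)
    rw [e, mul_pow, mul_pow, hD]
    generalize (δ + ‖x‖) ^ q = g at *
    generalize (δ + ‖y‖) ^ q = k at *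
    generalize inner ℝ x y = i at *
    have h2 : μ * g * (‖x‖ - ‖y‖) ≤ (q + 1) * g * (‖x‖ - ‖y‖) := by
      have : 0 ≤ g * (‖x‖ - ‖y‖) := mul_nonneg hg (by linarith)
      nlinarith
    have h3 : μ * g * (‖x‖ - ‖y‖) ≤ g * ‖x‖ - k * ‖y‖ := by
      have : 0 ≤ δ * (k - g) := mul_nonneg hδ (by linarith)
      linarith
    have h4 : (μ * g * (‖x‖ - ‖y‖)) ^ 2 ≤ (g * ‖x‖ - k * ‖y‖) ^ 2 :=
      pow_le_pow_left₀ (mul_nonneg (by positivity) (by linarith)) h3 2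
    have h5 : μ ^ 2 * g ^ 2 ≤ g * k := by
      have : μ ^ 2 ≤ 1 := by nlinarith
      nlinarith [mul_nonneg hg (sub_nonneg.2 hgg), sq_nonneg g]
    have h6 : μ ^ 2 * g ^ 2 * (‖x‖ * ‖y‖ - i) ≤ g * k * (‖x‖ * ‖y‖ - i) :=
      mul_le_mul_of_nonneg_right h5 (by linarith)
    linarith

lemma rpow_le_rpow_mul_of_comparable {m M q Q k : ℝ} (hm : 0 < m) (hk : 1 ≤ k) (hQ : |q| ≤ Q)
    (h1 : m ≤ k * M) (h2 : M ≤ k * m) : M ^ q ≤ k ^ Q * m ^ q := by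
  have hM : 0 < M := by by_contra hM; nlinarith
  have hmq := Real.rpow_pos_of_pos hm q
  rcases le_total 0 q with h | h
  · calc M ^ q ≤ (k * m) ^ q := by gcongr
      _ = k ^ q * m ^ q := Real.mul_rpow (by linarith) hm.le
      _ ≤ k ^ Q * m ^ q := by gcongr; exact (le_abs_self q).trans hQ
  · have h3 : m / k ≤ M := by rw [div_le_iff₀ (by linarith)]; linarith
    calc M ^ q ≤ (m / k) ^ q := Real.rpow_le_rpow_of_nonpos (by positivity) h3 h
      _ = k ^ (-q) * m ^ q := by
        rw [Real.div_rpow hm.le (by linarith), Real.rpow_neg (by linarith)]; ring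
      _ ≤ k ^ Q * m ^ q := by gcongr; exact (neg_le_abs q).trans hQ

/-- The vector field `x ↦ (δ+|x|)^q x` has increments comparable to `(δ+|x|+|x-y|)^q |x-y|`. -/
lemma exists_norm_rpow_smul_sub_comparable {μ Q : ℝ} (hμ : 0 < μ) (hμ1 : μ ≤ 1 / 2)
    (hQ : 1 ≤ Q) :
    ∃ K : ℝ, 1 ≤ K ∧ ∀ δ q : ℝ, 0 ≤ δ → μ - 1 ≤ q → q ≤ Q → ∀ x y : E,
      (δ + ‖x‖ + ‖x - y‖) ^ q * ‖x - y‖ ≤ K * ‖(δ + ‖x‖) ^ q • x - (δ + ‖y‖) ^ q • y‖ ∧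
      ‖(δ + ‖x‖) ^ q • x - (δ + ‖y‖) ^ q • y‖ ≤
        K * ((δ + ‖x‖ + ‖x - y‖) ^ q * ‖x - y‖) := by
  have h3 : (1 : ℝ) ≤ 3 ^ Q := Real.one_le_rpow (by norm_num) (by linarith)
  have hμ' : 1 ≤ μ⁻¹ := (one_le_inv₀ hμ).2 (by linarith)
  refine ⟨3 ^ Q * (μ⁻¹ * (1 + Q)), one_le_mul_of_one_le_of_one_le h3
    (one_le_mul_of_one_le_of_one_le hμ' (by linarith)), ?_⟩
  intro δ q hδ hq hqQ x y
  have key : ∀ z w : E, ‖w‖ ≤ ‖z‖ → ∀ M : ℝ, δ + ‖z‖ ≤ 3 * M → M ≤ 3 * (δ + ‖z‖) →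
      M ^ q * ‖z - w‖ ≤
        3 ^ Q * (μ⁻¹ * (1 + Q)) * ‖(δ + ‖z‖) ^ q • z - (δ + ‖w‖) ^ q • w‖ ∧
      ‖(δ + ‖z‖) ^ q • z - (δ + ‖w‖) ^ q • w‖ ≤
        3 ^ Q * (μ⁻¹ * (1 + Q)) * (M ^ q * ‖z - w‖) := by
    intro z w hwz M hM1 hM2
    rcases eq_or_ne z 0 with rfl | hz
    · have : w = 0 := by simpa using hwz
      subst this
      simp
    have hz' : 0 < ‖z‖ := norm_pos_iff.2 hz
    have hM : 0 < M := by linarith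
    have hq' : |q| ≤ Q := abs_le.2 ⟨by linarith, hqQ⟩
    have c1 := rpow_le_rpow_mul_of_comparable (m := δ + ‖z‖) (M := M) (by linarith)
      (by norm_num) hq' hM1 hM2
    have c2 := rpow_le_rpow_mul_of_comparable (m := M) (M := δ + ‖z‖) hM
      (by norm_num) hq' hM2 hM1
    have l1 := norm_rpow_smul_sub_le hδ (by linarith) hqQ hQ hwz
    have l2 := le_norm_rpow_smul_sub hδ hμ.le hμ1 hq hwz
    rw [← le_inv_mul_iff₀ hμ] at l2
    set N := ‖(δ + ‖z‖) ^ q • z - (δ + ‖w‖) ^ q • w‖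
    have hN : 0 ≤ N := norm_nonneg _
    constructor
    · calc M ^ q * ‖z - w‖ ≤ 3 ^ Q * (δ + ‖z‖) ^ q * ‖z - w‖ := by gcongr
        _ = 3 ^ Q * ((δ + ‖z‖) ^ q * ‖z - w‖) := by ring
        _ ≤ 3 ^ Q * (μ⁻¹ * N) := by gcongr
        _ ≤ 3 ^ Q * (μ⁻¹ * ((1 + Q) * N)) := by gcongr; nlinarith
        _ = _ := by ring
    · calc N ≤ (1 + Q) * ((δ + ‖z‖) ^ q * ‖z - w‖) := l1
        _ ≤ (1 + Q) * (3 ^ Q * M ^ q * ‖z - w‖) := by gcongr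
        _ = 1 * (1 + Q) * (3 ^ Q * M ^ q * ‖z - w‖) := by ring
        _ ≤ μ⁻¹ * (1 + Q) * (3 ^ Q * M ^ q * ‖z - w‖) := by gcongr
        _ = _ := by ring
  have t1 := norm_sub_le x y
  have t2 : ‖y‖ ≤ ‖x‖ + ‖x - y‖ := norm_le_norm_add_norm_sub x y
  have n1 := norm_nonneg x
  have n2 := norm_nonneg y
  have n3 := norm_nonneg (x - y)
  rcases le_total ‖y‖ ‖x‖ with h | h
  · exact key x y h _ (by linarith) (by linarith)
  · rw [norm_sub_rev x y, norm_sub_rev ((δ + ‖x‖) ^ q • x)]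
    rw [norm_sub_rev x y] at t1 t2 n3
    exact key y x h _ (by linarith) (by linarith)

end Quasinorm

section Conjugate

lemma shift_rpow_mul_le {σ p m l t : ℝ} (hσ : 0 ≤ σ) (hm1 : m ≤ 1) (hmp : m ≤ p - 1)
    (hl : 0 < l) (hl1 : l ≤ 1) (ht : 0 ≤ t) :
    (σ + l * t) ^ (p - 2) * (l * t) ≤ l ^ m * ((σ + t) ^ (p - 2) * t) := by
  rcases ht.eq_or_lt with rfl | ht
  · simp
  have hP := Real.rpow_pos_of_pos (show 0 < σ + t by linarith) (p - 2)
  have hlt : 0 < l * t := by positivity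
  rcases le_total 0 (p - 2) with h | h
  · have h1 : l * t ≤ t := by nlinarith
    have h2 : l ^ (1 : ℝ) ≤ l ^ m := Real.rpow_le_rpow_of_exponent_ge hl hl1 hm1
    rw [Real.rpow_one] at h2
    calc (σ + l * t) ^ (p - 2) * (l * t) ≤ (σ + t) ^ (p - 2) * (l * t) := by gcongr
      _ = l * ((σ + t) ^ (p - 2) * t) := by ring
      _ ≤ _ := by gcongr
  · have h1 : (σ + l * t) ^ (p - 2) ≤ (l * (σ + t)) ^ (p - 2) :=
      Real.rpow_le_rpow_of_nonpos (by positivity) (by nlinarith) h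
    rw [Real.mul_rpow hl.le (by linarith)] at h1
    have h2 : l ^ (p - 2) * l = l ^ (p - 1) := by
      rw [← Real.rpow_add_one hl.ne']; ring_nf
    have h3 : l ^ (p - 1) ≤ l ^ m := Real.rpow_le_rpow_of_exponent_ge hl hl1 hmp
    calc (σ + l * t) ^ (p - 2) * (l * t) ≤ l ^ (p - 2) * (σ + t) ^ (p - 2) * (l * t) := by
          gcongr
      _ = l ^ (p - 2) * l * ((σ + t) ^ (p - 2) * t) := by ring
      _ = l ^ (p - 1) * ((σ + t) ^ (p - 2) * t) := by rw [h2]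
      _ ≤ _ := by gcongr

lemma monotoneOn_shift_rpow_mul {σ p : ℝ} (hσ : 0 ≤ σ) (hp : 1 < p) :
    MonotoneOn (fun s : ℝ => (σ + s) ^ (p - 2) * s) (Set.Ici 0) := by
  intro s hs t ht hst
  rw [Set.mem_Ici] at hs ht
  rcases hs.eq_or_lt with rfl | hs
  · simp only [mul_zero]; positivity
  have ht' : 0 < t := hs.trans_le hst
  have h := shift_rpow_mul_le (σ := σ) (p := p) (m := 0) hσ (by linarith) (by linarith)
    (div_pos hs ht') ((div_le_one ht').2 hst) ht
  rwa [div_mul_cancel₀ _ ht'.ne', Real.rpow_zero, one_mul] at h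

lemma intervalIntegrable_shift_rpow_mul {σ p r s : ℝ} (hσ : 0 ≤ σ) (hp : 1 < p) (hr : 0 ≤ r)
    (hs : 0 ≤ s) : IntervalIntegrable (fun t : ℝ => (σ + t) ^ (p - 2) * t) volume r s :=
  ((monotoneOn_shift_rpow_mul hσ hp).mono fun _ ht => (le_min hr hs).trans ht.1).intervalIntegrable

lemma phiShift_le {δ a p s : ℝ} (hσ : 0 ≤ δ + a) (hp : 1 < p) (hs : 0 ≤ s) :
    phiShift δ p a s ≤ s * ((δ + a + s) ^ (p - 2) * s) := by
  have h := intervalIntegral.integral_mono_on hs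
    (intervalIntegrable_shift_rpow_mul hσ hp le_rfl hs)
    (intervalIntegrable_const (c := (δ + a + s) ^ (p - 2) * s))
    (fun t ht => monotoneOn_shift_rpow_mul hσ hp ht.1 hs ht.2)
  rw [intervalIntegral.integral_const, smul_eq_mul, sub_zero] at h
  exact h

lemma le_phiShift {δ a p s : ℝ} (hσ : 0 ≤ δ + a) (hp : 1 < p) (hs : 0 ≤ s) :
    s / 2 * ((δ + a + s / 2) ^ (p - 2) * (s / 2)) ≤ phiShift δ p a s := by
  have hs2 : 0 ≤ s / 2 := by linarith
  have h := intervalIntegral.integral_mono_on (show s / 2 ≤ s by linarith)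
    (intervalIntegrable_const (c := (δ + a + s / 2) ^ (p - 2) * (s / 2)))
    (intervalIntegrable_shift_rpow_mul hσ hp hs2 hs)
    (fun t ht => monotoneOn_shift_rpow_mul hσ hp hs2 (hs2.trans ht.1) ht.1)
  have h0 : 0 ≤ ∫ t in (0 : ℝ)..(s / 2), (δ + a + t) ^ (p - 2) * t :=
    intervalIntegral.integral_nonneg hs2 fun t ht =>
      mul_nonneg (Real.rpow_nonneg (by linarith [ht.1]) _) ht.1
  rw [phiShift, ← intervalIntegral.integral_add_adjacent_intervals
    (intervalIntegrable_shift_rpow_mul hσ hp le_rfl hs2)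
    (intervalIntegrable_shift_rpow_mul hσ hp hs2 hs)]
  rw [intervalIntegral.integral_const, smul_eq_mul, sub_half] at h
  linarith

/-- If `r` is comparable to `φ_a'(D)`, then `(φ_a)*(r)` is comparable to `φ_a'(D) D`. -/
lemma exists_fconj_phiShift_comparable {m K : ℝ} (hm : 0 < m) (hm1 : m ≤ 1) (hK : 1 ≤ K) :
    ∃ L : ℝ, 1 ≤ L ∧ ∀ δ a p D r : ℝ, 0 ≤ δ + a → m ≤ p - 1 → 0 ≤ D →
      (δ + a + D) ^ (p - 2) * D ≤ K * r → r ≤ K * ((δ + a + D) ^ (p - 2) * D) →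
      (δ + a + D) ^ (p - 2) * D * D ≤ L * fconj (phiShift δ p a) r ∧
      fconj (phiShift δ p a) r ≤ L * ((δ + a + D) ^ (p - 2) * D * D) := by
  have h2K : (1 : ℝ) ≤ 2 * K := by linarith
  have h2K0 : (0 : ℝ) ≤ 2 * K := by linarith
  obtain ⟨ε, hε, hε1, hεm⟩ : ∃ ε : ℝ, 0 < ε ∧ ε ≤ 1 ∧ ε ^ m = (2 * K)⁻¹ := by
    refine ⟨((2 * K)⁻¹) ^ m⁻¹, by positivity,
      Real.rpow_le_one (by positivity) (inv_le_one_of_one_le₀ h2K) (by positivity), ?_⟩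
    rw [← Real.rpow_mul (by positivity), inv_mul_cancel₀ hm.ne', Real.rpow_one]
  have hεi : 1 ≤ ε⁻¹ := (one_le_inv₀ hε).2 hε1
  refine ⟨2 * K * ε⁻¹, one_le_mul_of_one_le_of_one_le h2K hεi, ?_⟩
  intro δ a p D r hσ hmp hD hr1 hr2
  have hp : 1 < p := by linarith
  have hT : 0 ≤ (δ + a + D) ^ (p - 2) * D := by positivity
  have hr : 0 ≤ r := by by_contra h; nlinarith
  have upper : ∀ s : NNReal, r * (s : ℝ) - phiShift δ p a s
      ≤ 2 * K * ε⁻¹ * ((δ + a + D) ^ (p - 2) * D * D) := by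
    intro s
    have hs : (0 : ℝ) ≤ s := s.2
    have hphi := le_phiShift hσ hp hs
    have hs2 : (0 : ℝ) ≤ (s : ℝ) / 2 := by positivity
    rcases le_total ((s : ℝ) / 2) (ε⁻¹ * D) with h | h
    · have h0 : 0 ≤ (s : ℝ) / 2 * ((δ + a + s / 2) ^ (p - 2) * (s / 2)) := by positivity
      calc r * (s : ℝ) - phiShift δ p a s ≤ r * s := by linarith
        _ ≤ K * ((δ + a + D) ^ (p - 2) * D) * (2 * (ε⁻¹ * D)) := by gcongr; linarith
        _ = _ := by ring
    · have hεD : D = ε * (ε⁻¹ * D) := by field_simp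
      have h1 := shift_rpow_mul_le (σ := δ + a) (p := p) hσ hm1 hmp hε hε1
        (t := ε⁻¹ * D) (by positivity)
      rw [← hεD, hεm, ← div_eq_inv_mul, le_div_iff₀ (by linarith)] at h1
      have h2 := monotoneOn_shift_rpow_mul hσ hp
        (show ε⁻¹ * D ∈ Set.Ici 0 from by simp only [Set.mem_Ici]; positivity)
        (show (s : ℝ) / 2 ∈ Set.Ici 0 from hs2) h
      have h3 : 2 * r ≤ (δ + a + s / 2) ^ (p - 2) * (s / 2) := by
        simp only at h2
        linarith
      have h4 : (s : ℝ) / 2 * (2 * r) ≤ s / 2 * ((δ + a + s / 2) ^ (p - 2) * (s / 2)) := by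
        gcongr
      have h5 : 0 ≤ 2 * K * ε⁻¹ * ((δ + a + D) ^ (p - 2) * D * D) := by positivity
      linarith
  refine ⟨?_, ciSup_le upper⟩
  have hle : r * (ε * D) - phiShift δ p a (ε * D) ≤ fconj (phiShift δ p a) r :=
    le_ciSup (f := fun s : NNReal => r * (s : ℝ) - phiShift δ p a s)
      ⟨_, Set.forall_mem_range.2 upper⟩ ⟨ε * D, by positivity⟩
  have h1 := phiShift_le hσ hp (show 0 ≤ ε * D by positivity)
  have h2 := shift_rpow_mul_le (σ := δ + a) (p := p) hσ hm1 hmp hε hε1 hD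
  rw [hεm, ← div_eq_inv_mul, le_div_iff₀ (by linarith)] at h2
  set T := (δ + a + D) ^ (p - 2) * D
  set H := (δ + a + ε * D) ^ (p - 2) * (ε * D)
  have h3 : T * D ≤ 2 * K * ε⁻¹ * (r * (ε * D) - ε * D * H) := by
    have e : 2 * K * ε⁻¹ * (r * (ε * D) - ε * D * H) = (2 * (K * r) - H * (2 * K)) * D := by
      field_simp
    rw [e]
    gcongr
    linarith
  refine h3.trans ?_
  gcongr
  linarith

end Conjugate

lemma frob_eq_norm_toLp {d : ℕ} (A : Matrix (Fin d) (Fin d) ℝ) :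
    frob A = ‖WithLp.toLp 2 (fun k : Fin d × Fin d => A k.1 k.2)‖ := by
  rw [frob, EuclideanSpace.norm_eq, Fintype.sum_prod_type]
  simp

theorem stmt6 (d : ℕ) (hd : 1 ≤ d) (δ pm pp : ℝ) (hδ : 0 ≤ δ) (hpm : 1 < pm)
    (hpmpp : pm ≤ pp) :
    ∃ c : ℝ, 1 ≤ c ∧ ∀ p : ℝ, pm ≤ p → p ≤ pp → ∀ A B : Matrix (Fin d) (Fin d) ℝ,
      c⁻¹ * fconj (phiShift δ p (frob (msym A))) (frob (Smap δ p A - Smap δ p B)) ≤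
          frob (Fmap δ p A - Fmap δ p B) ^ 2 ∧
      frob (Fmap δ p A - Fmap δ p B) ^ 2 ≤
          c * fconj (phiShift δ p (frob (msym A))) (frob (Smap δ p A - Smap δ p B)) := by
  obtain ⟨K, hK, key⟩ := exists_norm_rpow_smul_sub_comparable
    (E := EuclideanSpace ℝ (Fin d × Fin d)) (μ := min (pm - 1) (1 / 2)) (Q := pp)
    (lt_min (by linarith) (by norm_num)) (min_le_right _ _) (by linarith)
  obtain ⟨L, hL, conj⟩ := exists_fconj_phiShift_comparable (m := min (pm - 1) 1) (K := K)
    (lt_min (by linarith) one_pos) (min_le_right _ _) hK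
  refine ⟨L * K ^ 2, one_le_mul_of_one_le_of_one_le hL (one_le_pow₀ hK), ?_⟩
  intro p hp1 hp2 A B
  have hm1 := min_le_left (pm - 1) (1 / 2)
  have hm2 := min_le_right (pm - 1) (1 / 2)
  set x : EuclideanSpace ℝ (Fin d × Fin d) := WithLp.toLp 2 (fun k => msym A k.1 k.2)
  set y : EuclideanSpace ℝ (Fin d × Fin d) := WithLp.toLp 2 (fun k => msym B k.1 k.2)
  have eA : frob (msym A) = ‖x‖ := frob_eq_norm_toLp _
  have eB : frob (msym B) = ‖y‖ := frob_eq_norm_toLp _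
  have eS : frob (Smap δ p A - Smap δ p B)
      = ‖(δ + ‖x‖) ^ (p - 2) • x - (δ + ‖y‖) ^ (p - 2) • y‖ := by
    rw [frob_eq_norm_toLp, Smap, Smap, eA, eB]; rfl
  have eF : frob (Fmap δ p A - Fmap δ p B)
      = ‖(δ + ‖x‖) ^ ((p - 2) / 2) • x - (δ + ‖y‖) ^ ((p - 2) / 2) • y‖ := by
    rw [frob_eq_norm_toLp, Fmap, Fmap, eA, eB]; rfl
  obtain ⟨s1, s2⟩ := key δ (p - 2) hδ (by linarith) (by linarith) x y
  obtain ⟨f1, f2⟩ := key δ ((p - 2) / 2) hδ (by linarith) (by linarith) x y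
  rw [← eS] at s1 s2
  rw [← eF] at f1 f2
  obtain ⟨c1, c2⟩ := conj δ ‖x‖ p ‖x - y‖ _ (by positivity)
    ((min_le_left _ _).trans (by linarith)) (norm_nonneg _) s1 s2
  rw [eA]
  have hM : 0 ≤ δ + ‖x‖ + ‖x - y‖ := by positivity
  have eM : ((δ + ‖x‖ + ‖x - y‖) ^ ((p - 2) / 2) * ‖x - y‖) ^ 2
      = (δ + ‖x‖ + ‖x - y‖) ^ (p - 2) * ‖x - y‖ * ‖x - y‖ := by
    rw [mul_pow, ← Real.rpow_natCast, ← Real.rpow_mul hM]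
    push_cast
    rw [div_mul_cancel₀ _ (two_ne_zero' ℝ)]
    ring
  have hF : 0 ≤ frob (Fmap δ p A - Fmap δ p B) := Real.sqrt_nonneg _
  have g1 := pow_le_pow_left₀ (by positivity) f1 2
  have g2 := pow_le_pow_left₀ hF f2 2
  rw [eM, mul_pow] at g1
  rw [mul_pow K, eM] at g2
  constructor
  · rw [inv_mul_le_iff₀ (by positivity), mul_assoc]
    exact c2.trans (by gcongr)
  · refine g2.trans ?_
    calc _ ≤ K ^ 2 * (L * fconj (phiShift δ p ‖x‖) (frob (Smap δ p A - Smap δ p B))) := by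
          gcongr
      _ = _ := by ring
end

section
/- Let d ≥ 1, δ ≥ 0 and 1 < p⁻ ≤ p⁺ < ∞. There exists a constant c ≥ 1, depending only on d, p⁻, p⁺ and δ, such that for every exponent p ∈ [p⁻, p⁺], every matrix A ∈ ℝ^{d×d} and every r ≥ 0: c⁻¹ ((φ_p)_{|A^sym|})*(r) ≤ ((φ_p)*)_{|S_p(A)|}(r) ≤ c ((φ_p)_{|A^sym|})*(r). -/
open MeasureTheory

/-- The N-function `φ_p(r) = ∫₀^r (δ+s)^{p-2} s ds`. -/
noncomputable def phi (δ p r : ℝ) : ℝ :=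
  phiShift δ p 0 r

/-- The shifted conjugate `((φ_p)*)_a(r) := ∫₀^r ((φ_p)*)'(a+s) · s/(a+s) ds`. -/
noncomputable def conjShift (δ p a r : ℝ) : ℝ :=
  ∫ s in (0:ℝ)..r, deriv (fconj (phi δ p)) (a + s) * (s / (a + s))

open Set Filter Topology

/-- The derivative `s ↦ (c+s)^{p-2} s` of an N-function of power type with offset `c`. -/
noncomputable def flux (c p s : ℝ) : ℝ := (c + s) ^ (p - 2) * s

lemma phiShift_eq_integral_flux (δ p a : ℝ) :
    phiShift δ p a = fun r => ∫ s in (0:ℝ)..r, flux (δ + a) p s := rfl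

lemma flux_zero (c p : ℝ) : flux c p 0 = 0 := by simp [flux]

lemma flux_nonneg {c : ℝ} (p : ℝ) {s : ℝ} (hc : 0 ≤ c) (hs : 0 ≤ s) : 0 ≤ flux c p s := by
  unfold flux; positivity

lemma flux_pos {c : ℝ} (p : ℝ) {s : ℝ} (hc : 0 ≤ c) (hs : 0 < s) : 0 < flux c p s := by
  unfold flux; positivity

lemma flux_eq_rpow_mul_div {c s : ℝ} (p : ℝ) (hc : 0 ≤ c) (hs : 0 < s) :
    flux c p s = (c + s) ^ (p - 1) * (s / (c + s)) := by
  have h : 0 < c + s := by linarith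
  rw [flux, show p - 1 = (p - 2) + 1 by ring, Real.rpow_add_one h.ne']
  field_simp

lemma continuousOn_flux {c p : ℝ} (hc : 0 ≤ c) (hp : 1 < p) :
    ContinuousOn (flux c p) (Ici 0) := by
  rcases hc.eq_or_lt with rfl | hc'
  · have h : ContinuousOn (fun s : ℝ => s ^ (p - 1)) (Ici 0) :=
      (Real.continuous_rpow_const (by linarith)).continuousOn
    refine h.congr fun s hs => ?_
    rcases (mem_Ici.1 hs).eq_or_lt with rfl | hs
    · rw [flux_zero]
      exact (Real.zero_rpow (by linarith)).symm
    · rw [flux_eq_rpow_mul_div p le_rfl hs, zero_add, div_self hs.ne', mul_one]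
  · unfold flux
    refine ContinuousOn.mul (ContinuousOn.rpow_const (by fun_prop) fun s hs => Or.inl ?_)
      continuousOn_id
    have := mem_Ici.1 hs
    linarith

lemma strictMonoOn_flux {c p : ℝ} (hc : 0 ≤ c) (hp : 1 < p) :
    StrictMonoOn (flux c p) (Ici 0) := by
  intro x hx y hy hxy
  rcases (mem_Ici.1 hx).eq_or_lt with rfl | hx
  · rw [flux_zero]; exact flux_pos p hc hxy
  · have hy : 0 < y := hx.trans hxy
    rw [flux_eq_rpow_mul_div p hc hx, flux_eq_rpow_mul_div p hc hy]
    have h₁ : (c + x) ^ (p - 1) < (c + y) ^ (p - 1) :=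
      Real.rpow_lt_rpow (by linarith) (by linarith) (by linarith)
    have h₂ : x / (c + x) ≤ y / (c + y) := by
      rw [div_le_div_iff₀ (by linarith) (by linarith)]
      nlinarith
    exact mul_lt_mul h₁ h₂ (by positivity) (by positivity)

lemma tendsto_flux_atTop {c p : ℝ} (hc : 0 ≤ c) (hp : 1 < p) :
    Tendsto (flux c p) atTop atTop := by
  have h : Tendsto (fun s : ℝ => (c + s) ^ (p - 1) * (1 / (c + 1))) atTop atTop :=
    ((tendsto_rpow_atTop (by linarith)).comp
      (tendsto_atTop_add_const_left _ c tendsto_id)).atTop_mul_const (by positivity)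
  refine tendsto_atTop_mono' _ ?_ h
  filter_upwards [eventually_ge_atTop (1 : ℝ)] with s hs
  rw [flux_eq_rpow_mul_div p hc (by linarith)]
  gcongr ?_ * ?_
  rw [div_le_div_iff₀ (by linarith) (by linarith)]
  nlinarith

/-- A continuous strictly increasing bijection of the half-line has a continuous inverse,
extended by zero to negative arguments. -/
lemma exists_continuous_inverse {f : ℝ → ℝ} (hf0 : f 0 = 0) (hfc : ContinuousOn f (Ici 0))
    (hfm : StrictMonoOn f (Ici 0)) (hft : Tendsto f atTop atTop) :
    ∃ g : ℝ → ℝ, Continuous g ∧ (∀ r, 0 ≤ g r) ∧ (∀ r, 0 ≤ r → f (g r) = r) ∧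
      ∀ r, r < 0 → g r = 0 := by
  set F : ℝ → ℝ := fun s => f (max s 0) + min s 0 with hF
  have hFp : ∀ s, 0 ≤ s → F s = f s := fun s hs => by simp [hF, hs]
  have hFn : ∀ s, s ≤ 0 → F s = s := fun s hs => by simp [hF, hs, hf0]
  have hFc : Continuous F := by
    refine Continuous.add ?_ (by fun_prop)
    exact hfc.comp_continuous (by fun_prop) fun s => le_max_right s 0
  have hFm : StrictMono F := by
    refine StrictMonoOn.Iic_union_Ici (a := (0 : ℝ)) ?_ ?_
    · intro x hx y hy hxy
      rwa [hFn x hx, hFn y hy]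
    · intro x hx y hy hxy
      rw [hFp x hx, hFp y hy]
      exact hfm hx hy hxy
  have hFs : Function.Surjective F := by
    refine hFc.surjective ?_ ?_
    · refine hft.congr' ?_
      filter_upwards [eventually_ge_atTop (0 : ℝ)] with s hs
      exact (hFp s hs).symm
    · refine tendsto_id.congr' ?_
      filter_upwards [eventually_le_atBot (0 : ℝ)] with s hs
      exact (hFn s hs).symm
  set e := hFm.orderIsoOfSurjective F hFs
  have he : ∀ r, F (e.symm r) = r := fun r => e.apply_symm_apply r
  refine ⟨fun r => max (e.symm r) 0, by have := e.symm.continuous; fun_prop,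
    fun r => le_max_right _ _, fun r hr => ?_, fun r hr => ?_⟩
  · have h : 0 ≤ e.symm r := by
      by_contra! h
      have := he r
      rw [hFn _ h.le] at this
      linarith
    simp only [max_eq_left h]
    rw [← hFp _ h, he]
  · refine max_eq_right ?_
    by_contra! h
    have h' := hFm h
    rw [he, hFn 0 le_rfl] at h'
    linarith

/-- The Fenchel conjugate is differentiable with derivative the maximizer, if the maximizer
depends continuously on the slope. -/
lemma hasDerivAt_fconj {ψ g : ℝ → ℝ} (hgc : Continuous g) (hg : ∀ r, 0 ≤ g r)
    (hmax : ∀ r s, 0 ≤ s → r * s - ψ s ≤ r * g r - ψ (g r)) (r : ℝ) :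
    HasDerivAt (fconj ψ) (g r) r := by
  have hval : ∀ x, fconj ψ x = x * g x - ψ (g x) := by
    intro x
    refine le_antisymm (ciSup_le fun s => hmax x s s.2) ?_
    exact le_ciSup (f := fun s : NNReal => x * (s : ℝ) - ψ s)
      ⟨x * g x - ψ (g x), by rintro _ ⟨s, rfl⟩; exact hmax x s s.2⟩ ⟨g x, hg x⟩
  have hlow : ∀ x y, g x * (y - x) ≤ fconj ψ y - fconj ψ x := by
    intro x y
    have := hmax y (g x) (hg x)
    rw [hval, hval]
    linarith
  rw [hasDerivAt_iff_isLittleO, Asymptotics.isLittleO_iff]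
  intro ε hε
  have hnear : ∀ᶠ y in 𝓝 r, |g y - g r| < ε := by
    have := Metric.tendsto_nhds.1 (hgc.tendsto r) ε hε
    simpa [Real.dist_eq] using this
  filter_upwards [hnear] with y hy
  have h₁ := hlow r y
  have h₂ := hlow y r
  rw [smul_eq_mul, Real.norm_eq_abs, Real.norm_eq_abs, abs_of_nonneg (by linarith)]
  calc fconj ψ y - fconj ψ r - (y - r) * g r ≤ (g y - g r) * (y - r) := by linarith
    _ ≤ |g y - g r| * |y - r| := by rw [← abs_mul]; exact le_abs_self _
    _ ≤ ε * |y - r| := by gcongr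

lemma intervalIntegrable_of_continuousOn_Ici {f : ℝ → ℝ} (hfc : ContinuousOn f (Ici 0))
    {x y : ℝ} (hx : 0 ≤ x) (hy : 0 ≤ y) : IntervalIntegrable f volume x y :=
  (hfc.mono fun _ hs => (le_min hx hy).trans hs.1).intervalIntegrable

lemma mul_sub_le_integral_of_monotoneOn {f : ℝ → ℝ} (hfc : ContinuousOn f (Ici 0))
    (hfm : MonotoneOn f (Ici 0)) {u s : ℝ} (hu : 0 ≤ u) (hs : 0 ≤ s) :
    f u * (s - u) ≤ ∫ x in u..s, f x := by
  rcases le_total u s with h | h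
  · have := intervalIntegral.integral_mono_on h (f := fun _ => f u) (g := f) (by simp)
      (intervalIntegrable_of_continuousOn_Ici hfc hu hs)
      (fun x hx => hfm hu (hu.trans hx.1) hx.1)
    simpa [mul_comm] using this
  · have := intervalIntegral.integral_mono_on h (f := f) (g := fun _ => f u)
      (intervalIntegrable_of_continuousOn_Ici hfc hs hu) (by simp)
      (fun x hx => hfm (hs.trans hx.1) hu hx.2)
    rw [intervalIntegral.integral_symm]
    simp only [intervalIntegral.integral_const, smul_eq_mul] at this
    linarith

/-- The conjugate of the primitive of `flux c p` is everywhere differentiable and its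
derivative is the inverse of `flux c p`. -/
lemma exists_hasDerivAt_fconj_integral_flux {c p : ℝ} (hc : 0 ≤ c) (hp : 1 < p) :
    ∃ g : ℝ → ℝ, Continuous g ∧ (∀ r, 0 ≤ g r) ∧ (∀ r, 0 ≤ r → flux c p (g r) = r) ∧
      (∀ r, HasDerivAt (fconj fun r => ∫ s in (0:ℝ)..r, flux c p s) (g r) r) ∧
      fconj (fun r => ∫ s in (0:ℝ)..r, flux c p s) 0 = 0 := by
  have hfc := continuousOn_flux hc hp
  have hfm := strictMonoOn_flux hc hp
  obtain ⟨g, hgc, hg, hgi, hgn⟩ := exists_continuous_inverse (flux_zero c p) hfc hfm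
    (tendsto_flux_atTop hc hp)
  have hpos : ∀ s, 0 ≤ s → 0 ≤ ∫ x in (0:ℝ)..s, flux c p x := fun s hs =>
    intervalIntegral.integral_nonneg hs fun x hx => flux_nonneg p hc hx.1
  refine ⟨g, hgc, hg, hgi, hasDerivAt_fconj hgc hg fun r s hs => ?_, ?_⟩
  · have hmain := mul_sub_le_integral_of_monotoneOn hfc hfm.monotoneOn (hg r) hs
    have hadd := intervalIntegral.integral_add_adjacent_intervals
      (intervalIntegrable_of_continuousOn_Ici hfc le_rfl (hg r))
      (intervalIntegrable_of_continuousOn_Ici hfc (hg r) hs)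
    rcases le_or_gt 0 r with hr | hr
    · rw [hgi r hr] at hmain
      linarith
    · rw [hgn r hr]
      have := hpos s hs
      simp only [mul_zero, intervalIntegral.integral_same]
      nlinarith
  · refine le_antisymm (ciSup_le fun s => ?_) ?_
    · have := hpos s s.2
      linarith
    · refine le_ciSup_of_le ⟨0, ?_⟩ (0 : NNReal) (by simp)
      rintro _ ⟨s, rfl⟩
      have := hpos s s.2
      simp only [zero_mul]
      linarith

lemma fconj_eq_integral {ψ g : ℝ → ℝ} (hgc : Continuous g)
    (hd : ∀ r, HasDerivAt (fconj ψ) (g r) r) (h0 : fconj ψ 0 = 0) (r : ℝ) :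
    fconj ψ r = ∫ t in (0:ℝ)..r, g t := by
  rw [intervalIntegral.integral_eq_sub_of_hasDerivAt (fun x _ => hd x)
    (hgc.intervalIntegrable _ _), h0, sub_zero]

lemma two_mul_flux_le {c p q x : ℝ} (hc : 0 ≤ c) (hq : 1 < q) (hqp : q ≤ p) (hp : p ≤ 2)
    (hx : 0 < x) : 2 * flux c p x ≤ flux c p (2 ^ (1 / (q - 1)) * x) := by
  set L : ℝ := 2 ^ (1 / (q - 1))
  have hL : 1 ≤ L := Real.one_le_rpow (by norm_num) (by
    have : 0 < q - 1 := by linarith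
    positivity)
  have hL2 : 2 ≤ L ^ (p - 1) := by
    calc (2 : ℝ) = L ^ (q - 1) := by
          rw [← Real.rpow_mul (by norm_num), one_div_mul_cancel (by linarith), Real.rpow_one]
      _ ≤ L ^ (p - 1) := Real.rpow_le_rpow_of_exponent_le hL (by linarith)
  have hL0 : 0 < L := by linarith
  have hf := flux_pos p hc hx
  calc 2 * flux c p x ≤ L ^ (p - 1) * flux c p x := by gcongr
    _ = (L * (c + x)) ^ (p - 2) * (L * x) := by
        rw [flux, Real.mul_rpow hL0.le (by linarith), show p - 1 = (p - 2) + 1 by ring,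
          Real.rpow_add_one hL0.ne']
        ring
    _ ≤ flux c p (L * x) := by
        unfold flux
        refine mul_le_mul_of_nonneg_right (Real.rpow_le_rpow_of_nonpos (by positivity) ?_
          (by linarith)) (by positivity)
        nlinarith

/-- If the flux at `h` is the sum of the flux at `a` and the shifted flux at `u`, then `h` is
comparable to `a + u`. -/
lemma comparable_of_flux_eq {δ p q a u h : ℝ} (hδ : 0 ≤ δ) (hq : 1 < q) (hqp : q ≤ p)
    (ha : 0 ≤ a) (hu : 0 < u) (hh : 0 < h)
    (heq : flux δ p h = flux δ p a + flux (δ + a) p u) :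
    a + u ≤ 2 * h ∧ h ≤ (2 + 2 ^ (1 / (q - 1))) * (a + u) := by
  have hp : 1 < p := by linarith
  have hmono := strictMonoOn_flux hδ hp
  have hle : ∀ {x y : ℝ}, 0 ≤ x → 0 ≤ y → flux δ p x ≤ flux δ p y → x ≤ y :=
    fun hx hy hxy => (hmono.le_iff_le hx hy).1 hxy
  have hL : (0 : ℝ) < 2 ^ (1 / (q - 1)) := by positivity
  have hsplit : flux δ p (a + u) = (δ + a + u) ^ (p - 2) * a + flux (δ + a) p u := by
    unfold flux; rw [← add_assoc]; ring
  rcases le_total 2 p with h2 | h2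
  · have h₁ : h ≤ a + u := by
      refine hle hh.le (by linarith) ?_
      rw [heq, hsplit]
      gcongr
      unfold flux
      refine mul_le_mul_of_nonneg_right ?_ ha
      exact Real.rpow_le_rpow (by linarith) (by linarith) (by linarith)
    have h₂ : a ≤ h := hle ha hh.le (by
      have := flux_nonneg p (add_nonneg hδ ha) hu.le
      linarith)
    have h₃ : u ≤ h := by
      refine hle hu.le hh.le ?_
      have h₄ : flux δ p u ≤ flux (δ + a) p u := by
        unfold flux
        refine mul_le_mul_of_nonneg_right ?_ hu.le
        exact Real.rpow_le_rpow (by linarith) (by linarith) (by linarith)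
      have := flux_nonneg p hδ ha
      linarith
    exact ⟨by linarith, by nlinarith [mul_pos hL (by linarith : 0 < a + u)]⟩
  · have h₁ : a + u ≤ h := by
      refine hle (by linarith) hh.le ?_
      rw [heq, hsplit]
      gcongr
      unfold flux
      rcases ha.eq_or_lt with rfl | ha'
      · simp
      · refine mul_le_mul_of_nonneg_right ?_ ha
        exact Real.rpow_le_rpow_of_nonpos (by linarith) (by linarith) (by linarith)
    have h₂ : h ≤ 2 ^ (1 / (q - 1)) * (a + u) := by
      refine hle hh.le (by positivity) ?_
      refine le_trans ?_ (two_mul_flux_le hδ hq hqp h2 (by linarith))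
      have h₃ : flux (δ + a) p u ≤ flux δ p u := by
        unfold flux
        refine mul_le_mul_of_nonneg_right ?_ hu.le
        exact Real.rpow_le_rpow_of_nonpos (by linarith) (by linarith) (by linarith)
      have h₄ : flux δ p u ≤ flux δ p (a + u) :=
        hmono.monotoneOn hu.le (show 0 ≤ a + u by linarith) (by linarith)
      have h₅ : flux δ p a ≤ flux δ p (a + u) :=
        hmono.monotoneOn ha (show 0 ≤ a + u by linarith) (by linarith)
      linarith
    exact ⟨by linarith, by nlinarith⟩

lemma rpow_mem_Icc_of_abs_le {K X e E : ℝ} (hK : 1 ≤ K) (hX : K⁻¹ ≤ X) (hX' : X ≤ K)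
    (he : |e| ≤ E) : (K ^ E)⁻¹ ≤ X ^ e ∧ X ^ e ≤ K ^ E := by
  have hK0 : 0 < K := by linarith
  have hX0 : 0 < X := (inv_pos.2 hK0).trans_le hX
  obtain ⟨he₁, he₂⟩ := abs_le.1 he
  have hlog : |Real.log X| ≤ Real.log K := by
    rw [abs_le]
    refine ⟨?_, Real.log_le_log hX0 hX'⟩
    rw [← Real.log_inv]
    exact Real.log_le_log (inv_pos.2 hK0) hX
  have hprod : |Real.log X * e| ≤ Real.log K * E := by
    rw [abs_mul]
    exact mul_le_mul hlog he (abs_nonneg _) (Real.log_nonneg hK)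
  rw [← Real.rpow_neg hK0.le, Real.rpow_def_of_pos hX0, Real.rpow_def_of_pos hK0,
    Real.rpow_def_of_pos hK0, Real.exp_le_exp, Real.exp_le_exp]
  have := abs_le.1 hprod
  exact ⟨by linarith, this.2⟩

/-- Pointwise comparison of the derivatives of the two conjugates. -/
lemma comparable_shifted_inverse {δ p q Q a u h : ℝ} (hδ : 0 ≤ δ) (hq : 1 < q) (hqp : q ≤ p)
    (hpQ : p ≤ Q) (ha : 0 ≤ a) (hu : 0 < u) (hh : 0 < h)
    (heq : flux δ p h = flux δ p a + flux (δ + a) p u) :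
    ((2 + 2 ^ (1 / (q - 1)) : ℝ) ^ Q)⁻¹ * u ≤ h * (flux (δ + a) p u / flux δ p h) ∧
      h * (flux (δ + a) p u / flux δ p h) ≤ (2 + 2 ^ (1 / (q - 1)) : ℝ) ^ Q * u := by
  obtain ⟨h₁, h₂⟩ := comparable_of_flux_eq hδ hq hqp ha hu hh heq
  have hL : (0 : ℝ) < 2 ^ (1 / (q - 1)) := by positivity
  set K : ℝ := 2 + 2 ^ (1 / (q - 1)) with hKdef
  have hK : 2 ≤ K := by linarith
  have hδh : 0 < δ + h := by linarith
  have hau : 0 < δ + a + u := by linarith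
  have hexpr : h * (flux (δ + a) p u / flux δ p h) =
      ((δ + a + u) / (δ + h)) ^ (p - 2) * u := by
    rw [Real.div_rpow hau.le hδh.le]
    unfold flux
    have := Real.rpow_pos_of_pos hδh (p - 2)
    field_simp
  have hX : K⁻¹ ≤ (δ + a + u) / (δ + h) := by
    rw [inv_eq_one_div, div_le_div_iff₀ (by linarith) hδh]
    nlinarith
  have hX' : (δ + a + u) / (δ + h) ≤ K := by
    rw [div_le_iff₀ hδh]
    nlinarith
  obtain ⟨h₃, h₄⟩ := rpow_mem_Icc_of_abs_le (E := Q) (by linarith) hX hX'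
    (abs_le.2 ⟨by linarith, by linarith⟩ : |p - 2| ≤ Q)
  rw [hexpr]
  exact ⟨by gcongr, by gcongr⟩

/-- The conjugate of the shifted N-function is comparable to the shifted conjugate. -/
lemma fconj_phiShift_comparable_conjShift {δ p q Q a r : ℝ} (hδ : 0 ≤ δ) (hq : 1 < q)
    (hqp : q ≤ p) (hpQ : p ≤ Q) (ha : 0 ≤ a) (hr : 0 ≤ r) :
    ((2 + 2 ^ (1 / (q - 1)) : ℝ) ^ Q)⁻¹ * fconj (phiShift δ p a) r ≤
        conjShift δ p (flux δ p a) r ∧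
      conjShift δ p (flux δ p a) r ≤
        (2 + 2 ^ (1 / (q - 1)) : ℝ) ^ Q * fconj (phiShift δ p a) r := by
  have hp : 1 < p := by linarith
  obtain ⟨g, hgc, hg, hgi, hgd, -⟩ := exists_hasDerivAt_fconj_integral_flux hδ hp
  obtain ⟨ga, hgac, hga, hgai, hgad, hga0⟩ :=
    exists_hasDerivAt_fconj_integral_flux (add_nonneg hδ ha) hp
  have hphi : phi δ p = fun r => ∫ s in (0:ℝ)..r, flux δ p s := by
    funext r
    rw [phi, phiShift_eq_integral_flux, add_zero]
  have hderiv : deriv (fconj (phi δ p)) = g := by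
    rw [hphi]
    exact funext fun x => (hgd x).deriv
  have hb : 0 ≤ flux δ p a := flux_nonneg p hδ ha
  rw [phiShift_eq_integral_flux, fconj_eq_integral hgac hgad hga0, conjShift, hderiv]
  set b := flux δ p a with hbdef
  set K : ℝ := 2 + 2 ^ (1 / (q - 1))
  have hpt : ∀ t ∈ Ioo 0 r, (K ^ Q)⁻¹ * ga t ≤ g (b + t) * (t / (b + t)) ∧
      g (b + t) * (t / (b + t)) ≤ K ^ Q * ga t := by
    intro t ht
    have hpos : ∀ {c x : ℝ}, 0 < flux c p x → 0 ≤ x → 0 < x := fun hf hx =>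
      hx.lt_of_ne (by rintro rfl; simp [flux_zero] at hf)
    have hbt : 0 < b + t := by linarith [ht.1]
    have e₁ := hgai t ht.1.le
    have e₂ := hgi (b + t) hbt.le
    have := comparable_shifted_inverse hδ hq hqp hpQ ha
      (hpos (e₁.symm ▸ ht.1) (hga t)) (hpos (e₂.symm ▸ hbt) (hg (b + t)))
      (by rw [e₁, e₂])
    rwa [e₁, e₂] at this
  have hint : IntervalIntegrable ga volume 0 r := hgac.intervalIntegrable _ _
  have hint' : IntervalIntegrable (fun t => g (b + t) * (t / (b + t))) volume 0 r := by
    have hdom : IntervalIntegrable (fun t => g (b + t)) volume 0 r :=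
      (hgc.comp (by fun_prop)).intervalIntegrable _ _
    refine hdom.mono_fun ?_ ?_
    · have := hgc.measurable
      exact Measurable.aestronglyMeasurable (by fun_prop)
    · rw [uIoc_of_le hr]
      filter_upwards [ae_restrict_mem measurableSet_Ioc] with t ht
      have hbt : 0 < b + t := by linarith [ht.1]
      rw [norm_mul]
      refine mul_le_of_le_one_right (norm_nonneg _) ?_
      rw [Real.norm_of_nonneg (div_nonneg ht.1.le hbt.le), div_le_one hbt]
      linarith
  rw [← intervalIntegral.integral_const_mul, ← intervalIntegral.integral_const_mul]
  exact ⟨intervalIntegral.integral_mono_on_of_le_Ioo hr (hint.const_mul _) hint'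
      fun t ht => (hpt t ht).1,
    intervalIntegral.integral_mono_on_of_le_Ioo hr hint' (hint.const_mul _)
      fun t ht => (hpt t ht).2⟩

lemma frob_smul {d : ℕ} {k : ℝ} (hk : 0 ≤ k) (A : Matrix (Fin d) (Fin d) ℝ) :
    frob (k • A) = k * frob A := by
  simp only [frob, Matrix.smul_apply, smul_eq_mul, mul_pow, ← Finset.mul_sum]
  rw [Real.sqrt_mul (sq_nonneg k), Real.sqrt_sq hk]

lemma frob_nonneg {d : ℕ} (A : Matrix (Fin d) (Fin d) ℝ) : 0 ≤ frob A := Real.sqrt_nonneg _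

lemma frob_Smap {d : ℕ} {δ : ℝ} (hδ : 0 ≤ δ) (p : ℝ) (A : Matrix (Fin d) (Fin d) ℝ) :
    frob (Smap δ p A) = flux δ p (frob (msym A)) :=
  frob_smul (Real.rpow_nonneg (add_nonneg hδ (frob_nonneg _)) _) _

theorem stmt8 (d : ℕ) (hd : 1 ≤ d) (δ pm pp : ℝ) (hδ : 0 ≤ δ) (hpm : 1 < pm)
    (hpmpp : pm ≤ pp) :
    ∃ c : ℝ, 1 ≤ c ∧ ∀ p : ℝ, pm ≤ p → p ≤ pp → ∀ A : Matrix (Fin d) (Fin d) ℝ,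
      ∀ r : ℝ, 0 ≤ r →
      c⁻¹ * fconj (phiShift δ p (frob (msym A))) r ≤
          conjShift δ p (frob (Smap δ p A)) r ∧
      conjShift δ p (frob (Smap δ p A)) r ≤
          c * fconj (phiShift δ p (frob (msym A))) r := by
  refine ⟨(2 + 2 ^ (1 / (pm - 1)) : ℝ) ^ pp, Real.one_le_rpow ?_ (by linarith),
    fun p hp hp' A r hr => ?_⟩
  · have : (0 : ℝ) < 2 ^ (1 / (pm - 1)) := by positivity
    linarith
  · rw [frob_Smap hδ]
    exact fconj_phiShift_comparable_conjShift hδ hpm hp hp' (frob_nonneg _) hr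
end

section
/- Key estimate: Let m ≥ 1, δ ≥ 0, 1 < p⁻ ≤ p⁺ < ∞, and let Q ⊂ ℝ^m be a cube with side length ℓ(Q) ≤ 1. Let p : Q → [p⁻, p⁺] be measurable and log-Hölder continuous with constant c_log, i.e. |p(z) − p(w)| ≤ c_log / (−log |z − w|) whenever 0 < |z − w| < ½. Then for each n > 0 there exists a constant c > 0, depending only on n, c_log and p⁻ (and on p⁺ and δ), such that for every shift a ≥ 0 and every integrable f : Q → ℝ satisfying ∫_Q |f(w)|^{p(w)/(p(w)−1)} dw < ∞ and a + ⨍_Q |f| dw ≤ |Q|^{−n}, one has for almost every z ∈ Q: ((φ_{p(z)})_a)*(⨍_Q |f| dw) ≤ c ( ⨍_Q ((φ_{p(w)})_a)*(|f(w)|) dw + |Q|^n ), where ⨍_Q denotes the average over Q and |Q| its Lebesgue measure. -/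
open MeasureTheory

/-- The axis-parallel cube with corner `z₀` and side length `ℓ` in `ℝ^m`. -/
def cube (m : ℕ) (z₀ : EuclideanSpace ℝ (Fin m)) (ℓ : ℝ) : Set (EuclideanSpace ℝ (Fin m)) :=
  {z | ∀ i, z₀ i ≤ z i ∧ z i ≤ z₀ i + ℓ}


/-! ### The density of the shifted N-function -/

theorem rpow_sub_two_mul_eq {b p t : ℝ} (h : 0 < b + t) :
    (b + t) ^ (p - 2) * t = (b + t) ^ (p - 1) * (t / (b + t)) := by
  rw [show p - 2 = (p - 1) - 1 by ring, Real.rpow_sub h, Real.rpow_one]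
  field_simp

theorem monotoneOn_shift_density {b p : ℝ} (hb : 0 ≤ b) (hp : 1 < p) :
    MonotoneOn (fun t : ℝ => (b + t) ^ (p - 2) * t) (Set.Ici 0) := by
  intro x hx y hy hxy
  simp only [Set.mem_Ici] at hx hy
  rcases hx.eq_or_lt with rfl | hx
  · simp only [mul_zero]; positivity
  · have hbx : 0 < b + x := by linarith
    have hby : 0 < b + y := by linarith
    simp only [rpow_sub_two_mul_eq hbx, rpow_sub_two_mul_eq hby]
    refine mul_le_mul (Real.rpow_le_rpow hbx.le (by linarith) (by linarith)) ?_
      (by positivity) (by positivity)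
    rw [div_le_div_iff₀ hbx hby]
    nlinarith

theorem intervalIntegrable_shift_density {b p s t : ℝ} (hb : 0 ≤ b) (hp : 1 < p)
    (hs : 0 ≤ s) (ht : 0 ≤ t) :
    IntervalIntegrable (fun t : ℝ => (b + t) ^ (p - 2) * t) volume s t :=
  ((monotoneOn_shift_density hb hp).mono
    fun _ hx => (le_inf hs ht).trans hx.1).intervalIntegrable

/-- If the density at `t` is at most `R`, then `b + t` is controlled by `b` and `R`. -/
theorem add_le_of_shift_density_le {b p t R : ℝ} (hb : 0 ≤ b) (hp : 1 < p) (ht : 0 < t)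
    (h : (b + t) ^ (p - 2) * t ≤ R) : b + t ≤ 2 * b + (2 * R) ^ (1 / (p - 1)) := by
  have hbt : 0 < b + t := by linarith
  have hR : 0 ≤ R := le_trans (by positivity) h
  have hpow : 0 ≤ (2 * R) ^ (1 / (p - 1)) := by positivity
  rcases le_total t b with htb | htb
  · linarith
  · rw [rpow_sub_two_mul_eq hbt] at h
    have h2 : (1 / 2 : ℝ) ≤ t / (b + t) := by
      rw [div_le_div_iff₀ (by norm_num) hbt]; linarith
    have h3 : (b + t) ^ (p - 1) ≤ 2 * R := by
      nlinarith [Real.rpow_pos_of_pos hbt (p - 1)]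
    have h4 := Real.rpow_le_rpow (by positivity) h3 (z := 1 / (p - 1))
      (by apply div_nonneg <;> linarith)
    rw [← Real.rpow_mul hbt.le, mul_one_div_cancel (by linarith), Real.rpow_one] at h4
    linarith

/-! ### The shifted N-function -/

theorem phiShift_sub {δ p a s t : ℝ} (hb : 0 ≤ δ + a) (hp : 1 < p) (hs : 0 ≤ s) (ht : 0 ≤ t) :
    phiShift δ p a t - phiShift δ p a s = ∫ x in s..t, (δ + a + x) ^ (p - 2) * x :=
  intervalIntegral.integral_interval_sub_left
    (intervalIntegrable_shift_density hb hp le_rfl ht)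
    (intervalIntegrable_shift_density hb hp le_rfl hs)

theorem phiShift_zero {δ p a : ℝ} : phiShift δ p a 0 = 0 := by simp [phiShift]

theorem phiShift_sub_ge {δ p a s t : ℝ} (hb : 0 ≤ δ + a) (hp : 1 < p) (hs : 0 ≤ s)
    (hst : s ≤ t) :
    (t - s) * ((δ + a + s) ^ (p - 2) * s) ≤ phiShift δ p a t - phiShift δ p a s := by
  rw [phiShift_sub hb hp hs (hs.trans hst)]
  have := intervalIntegral.integral_mono_on (μ := volume) hst
    (intervalIntegrable_const (c := (δ + a + s) ^ (p - 2) * s))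
    (intervalIntegrable_shift_density hb hp hs (hs.trans hst))
    fun x hx => monotoneOn_shift_density hb hp hs (hs.trans hx.1) hx.1
  rwa [intervalIntegral.integral_const, smul_eq_mul] at this

theorem phiShift_le_mul {δ p a t : ℝ} (hb : 0 ≤ δ + a) (hp : 1 < p) (ht : 0 ≤ t) :
    phiShift δ p a t ≤ t * ((δ + a + t) ^ (p - 2) * t) := by
  have := intervalIntegral.integral_mono_on (μ := volume) ht
    (intervalIntegrable_shift_density hb hp le_rfl ht)
    (intervalIntegrable_const (c := (δ + a + t) ^ (p - 2) * t))
    fun x hx => monotoneOn_shift_density hb hp hx.1 ht hx.2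
  rwa [intervalIntegral.integral_const, smul_eq_mul, sub_zero] at this

theorem phiShift_mono {δ p a s t : ℝ} (hb : 0 ≤ δ + a) (hp : 1 < p) (hs : 0 ≤ s)
    (hst : s ≤ t) : phiShift δ p a s ≤ phiShift δ p a t := by
  have h := phiShift_sub_ge hb hp hs hst
  have : 0 ≤ (t - s) * ((δ + a + s) ^ (p - 2) * s) :=
    mul_nonneg (sub_nonneg.2 hst) (mul_nonneg (Real.rpow_nonneg (by linarith) _) hs)
  linarith

theorem phiShift_nonneg {δ p a t : ℝ} (hb : 0 ≤ δ + a) (hp : 1 < p) (ht : 0 ≤ t) :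
    0 ≤ phiShift δ p a t := by
  simpa [phiShift_zero] using phiShift_mono hb hp le_rfl ht

theorem mul_le_phiShift_two_mul {δ p a t : ℝ} (hb : 0 ≤ δ + a) (hp : 1 < p) (ht : 0 ≤ t) :
    t * ((δ + a + t) ^ (p - 2) * t) ≤ phiShift δ p a (2 * t) := by
  have h := phiShift_sub_ge hb hp ht (by linarith : t ≤ 2 * t)
  rw [show 2 * t - t = t by ring] at h
  linarith [phiShift_nonneg hb hp ht]

/-- Scaling the argument by `l ≤ 1` gains the factor `l ^ q` for every `q ≤ min 2 p`. -/
theorem phiShift_mul_le {δ p a q l t : ℝ} (hb : 0 ≤ δ + a) (hp : 1 < p) (hq2 : q ≤ 2)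
    (hqp : q ≤ p) (hl : 0 < l) (hl1 : l ≤ 1) (ht : 0 < t) :
    phiShift δ p a (l * t) ≤ l ^ q * (t ^ 2 * (δ + a + t) ^ (p - 2)) := by
  set b := δ + a
  have hlt : 0 < l * t := by positivity
  have hbt : 0 < b + t := by linarith
  refine (phiShift_le_mul hb hp hlt.le).trans ?_
  change l * t * ((b + l * t) ^ (p - 2) * (l * t)) ≤ _
  have hlt1 : l * t ≤ t := mul_le_of_le_one_left ht.le hl1
  have hl2 : l ^ (2 : ℝ) = l ^ 2 := Real.rpow_two l
  have key : l ^ 2 * (b + l * t) ^ (p - 2) ≤ l ^ q * (b + t) ^ (p - 2) := by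
    rcases le_total 2 p with h2 | h2
    · refine mul_le_mul ?_ (Real.rpow_le_rpow (by positivity) (by linarith) (by linarith))
        (by positivity) (by positivity)
      rw [← hl2]
      exact Real.rpow_le_rpow_of_exponent_ge hl hl1 hq2
    · have h3 : (b + l * t) ^ (p - 2) ≤ (l * (b + t)) ^ (p - 2) :=
        Real.rpow_le_rpow_of_nonpos (by positivity) (by nlinarith) (by linarith)
      rw [Real.mul_rpow hl.le hbt.le] at h3
      calc l ^ 2 * (b + l * t) ^ (p - 2)
          ≤ l ^ 2 * (l ^ (p - 2) * (b + t) ^ (p - 2)) := by gcongr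
        _ = l ^ p * (b + t) ^ (p - 2) := by
            rw [← mul_assoc, ← hl2, ← Real.rpow_add hl]; ring_nf
        _ ≤ l ^ q * (b + t) ^ (p - 2) := by
            gcongr ?_ * _
            exact Real.rpow_le_rpow_of_exponent_ge hl hl1 hqp
  calc l * t * ((b + l * t) ^ (p - 2) * (l * t))
      = t ^ 2 * (l ^ 2 * (b + l * t) ^ (p - 2)) := by ring
    _ ≤ t ^ 2 * (l ^ q * (b + t) ^ (p - 2)) := by gcongr
    _ = _ := by ring

/-! ### The conjugate -/

/-- To bound `r s - φ(s)` it is enough to consider the points whose density is at most `2r`. -/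
theorem mul_sub_phiShift_le {δ p a r X : ℝ} (hb : 0 ≤ δ + a) (hp : 1 < p) (hX : 0 ≤ X)
    (h : ∀ t, 0 < t → (δ + a + t) ^ (p - 2) * t ≤ 2 * r → 2 * r * t ≤ X) {s : ℝ} (hs : 0 ≤ s) :
    r * s - phiShift δ p a s ≤ X := by
  rcases hs.eq_or_lt with rfl | hs
  · simpa [phiShift_zero] using hX
  have ht : 0 < s / 2 := by positivity
  have hst : 2 * (s / 2) = s := by ring
  by_cases hr : (δ + a + s / 2) ^ (p - 2) * (s / 2) ≤ 2 * r
  · have := h _ ht hr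
    linarith [phiShift_nonneg hb hp hs.le]
  · have := mul_le_phiShift_two_mul hb hp ht.le
    rw [hst] at this
    push Not at hr
    nlinarith

theorem mul_sub_phiShift_le_rpow {δ p a r s : ℝ} (hb : 0 ≤ δ + a) (hp : 1 < p) (hr : 0 ≤ r)
    (hs : 0 ≤ s) :
    r * s - phiShift δ p a s ≤ 2 * r * (2 * (δ + a) + (2 * (2 * r)) ^ (1 / (p - 1))) := by
  refine mul_sub_phiShift_le hb hp (by positivity) (fun t ht h => ?_) hs
  have := add_le_of_shift_density_le hb hp ht h
  gcongr
  linarith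

theorem bddAbove_mul_sub_phiShift {δ p a r : ℝ} (hb : 0 ≤ δ + a) (hp : 1 < p) (hr : 0 ≤ r) :
    BddAbove (Set.range fun s : NNReal => r * (s : ℝ) - phiShift δ p a s) :=
  ⟨_, Set.forall_mem_range.2 fun s => mul_sub_phiShift_le_rpow hb hp hr s.2⟩

theorem mul_sub_phiShift_le_fconj {δ p a r s : ℝ} (hb : 0 ≤ δ + a) (hp : 1 < p) (hr : 0 ≤ r)
    (hs : 0 ≤ s) : r * s - phiShift δ p a s ≤ fconj (phiShift δ p a) r :=
  le_ciSup (bddAbove_mul_sub_phiShift hb hp hr) ⟨s, hs⟩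

theorem fconj_phiShift_nonneg {δ p a r : ℝ} (hb : 0 ≤ δ + a) (hp : 1 < p) (hr : 0 ≤ r) :
    0 ≤ fconj (phiShift δ p a) r := by
  simpa [phiShift_zero] using mul_sub_phiShift_le_fconj hb hp hr le_rfl

theorem fconj_phiShift_le {δ p a r k : ℝ} (hb : 0 ≤ δ + a) (hp : 1 < p) (hr : 0 ≤ r)
    (hk : 1 / (p - 1) ≤ k) :
    fconj (phiShift δ p a) r ≤ 4 * (δ + a) * r + 2 * 4 ^ k * r ^ (p / (p - 1)) := by
  refine (ciSup_le fun s => mul_sub_phiShift_le_rpow hb hp hr s.2).trans ?_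
  have hp1 : 0 < p - 1 := by linarith
  have h1 : r * r ^ (1 / (p - 1)) = r ^ (p / (p - 1)) := by
    rw [show p / (p - 1) = 1 + 1 / (p - 1) by field_simp; ring,
      Real.rpow_add_of_nonneg hr zero_le_one (by positivity), Real.rpow_one]
  have h2 : (4 : ℝ) ^ (1 / (p - 1)) ≤ 4 ^ k :=
    Real.rpow_le_rpow_of_exponent_le (by norm_num) hk
  rw [show 2 * (2 * r) = 4 * r by ring, Real.mul_rpow (by norm_num) hr]
  have : 0 ≤ r ^ (p / (p - 1)) := by positivity
  calc 2 * r * (2 * (δ + a) + 4 ^ (1 / (p - 1)) * r ^ (1 / (p - 1)))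
      = 4 * (δ + a) * r + 2 * 4 ^ (1 / (p - 1)) * (r * r ^ (1 / (p - 1))) := by ring
    _ ≤ _ := by rw [h1]; gcongr

theorem measurable_phiShift (δ a : ℝ) {s : ℝ} (hs : 0 ≤ s) :
    Measurable fun p => phiShift δ p a s := by
  simp only [phiShift, intervalIntegral.integral_of_le hs]
  refine (StronglyMeasurable.integral_prod_right ?_).measurable
  refine Measurable.stronglyMeasurable ?_
  simp only [Function.uncurry_def]
  fun_prop

/-- The supremum defining the conjugate may be taken over the nonnegative rationals. -/
theorem fconj_phiShift_eq_iSup_nnrat {δ p a r : ℝ} (hb : 0 ≤ δ + a) (hp : 1 < p) (hr : 0 ≤ r) :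
    fconj (phiShift δ p a) r = ⨆ q : ℚ≥0, (r * (q : ℝ) - phiShift δ p a q) := by
  have hbdd : BddAbove (Set.range fun q : ℚ≥0 => r * (q : ℝ) - phiShift δ p a q) :=
    ⟨_, Set.forall_mem_range.2 fun q => mul_sub_phiShift_le_rpow hb hp hr q.cast_nonneg⟩
  refine le_antisymm (ciSup_le fun s => ?_)
    (ciSup_le fun q => mul_sub_phiShift_le_fconj hb hp hr q.cast_nonneg)
  refine le_of_forall_pos_le_add fun ε hε => ?_
  obtain ⟨q, hqs, hq⟩ : ∃ q : ℚ≥0, (q : ℝ) ≤ s ∧ r * s ≤ r * q + ε := by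
    rcases s.2.eq_or_lt with h0 | hs
    · exact ⟨0, by simp, by rw [← NNReal.val_eq_coe, ← h0]; simpa using hε.le⟩
    · have hlt : max 0 ((s : ℝ) - ε / (r + 1)) < s :=
        max_lt hs (sub_lt_self _ (by positivity))
      obtain ⟨q, h1, h2⟩ := exists_rat_btwn hlt
      have hq0 : 0 ≤ q := by exact_mod_cast (le_max_left _ _).trans h1.le
      lift q to ℚ≥0 using hq0
      rw [Rat.cast_nnratCast] at h1 h2
      refine ⟨q, h2.le, ?_⟩
      have h3 := (le_max_right _ _).trans h1.le
      have h4 : r * (ε / (r + 1)) ≤ ε := by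
        rw [mul_div_assoc', div_le_iff₀ (by positivity)]; nlinarith
      nlinarith
  have := le_ciSup hbdd q
  have := phiShift_mono hb hp q.cast_nonneg hqs
  linarith

/-! ### The cube -/

theorem cube_eq_preimage (m : ℕ) (z₀ : EuclideanSpace ℝ (Fin m)) (ℓ : ℝ) :
    cube m z₀ ℓ = WithLp.ofLp ⁻¹' Set.Icc (z₀ : Fin m → ℝ) (fun i => z₀ i + ℓ) := by
  ext z
  simp [cube, Set.mem_Icc, Pi.le_def, forall_and]

theorem measurableSet_cube (m : ℕ) (z₀ : EuclideanSpace ℝ (Fin m)) (ℓ : ℝ) :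
    MeasurableSet (cube m z₀ ℓ) := by
  rw [cube_eq_preimage]
  exact (PiLp.volume_preserving_ofLp (Fin m)).measurable measurableSet_Icc

theorem volume_cube (m : ℕ) (z₀ : EuclideanSpace ℝ (Fin m)) (ℓ : ℝ) :
    volume (cube m z₀ ℓ) = ENNReal.ofReal ℓ ^ m := by
  rw [cube_eq_preimage, (PiLp.volume_preserving_ofLp (Fin m)).measure_preimage
    measurableSet_Icc.nullMeasurableSet, Real.volume_Icc_pi]
  simp

theorem dist_le_of_mem_cube {m : ℕ} {z₀ z w : EuclideanSpace ℝ (Fin m)} {ℓ : ℝ} (hℓ : 0 ≤ ℓ)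
    (hz : z ∈ cube m z₀ ℓ) (hw : w ∈ cube m z₀ ℓ) : dist z w ≤ m * ℓ := by
  rw [EuclideanSpace.dist_eq]
  refine Real.sqrt_le_iff.2 ⟨by positivity, ?_⟩
  calc ∑ i, dist (z i) (w i) ^ 2 ≤ ∑ _i : Fin m, ℓ ^ 2 := by
        gcongr with i
        rw [Real.dist_eq, abs_le]
        constructor <;> linarith [(hz i).1, (hz i).2, (hw i).1, (hw i).2]
    _ = m * ℓ ^ 2 := by simp
    _ ≤ (m * ℓ) ^ 2 := by
        rw [mul_pow]
        gcongr
        exact_mod_cast Nat.le_self_pow two_ne_zero m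

/-- On a cube the oscillation of a log-Hölder exponent is `O(1 / log (1 / ℓ))`. -/
theorem osc_mul_neg_log_le {m : ℕ} (hm : 1 ≤ m) {pm pp clog ℓ : ℝ} (hpmpp : pm ≤ pp)
    (hclog : 0 ≤ clog) (hℓ : 0 < ℓ) (hℓ1 : ℓ ≤ 1) {z₀ : EuclideanSpace ℝ (Fin m)}
    {p : EuclideanSpace ℝ (Fin m) → ℝ} (hp : ∀ z ∈ cube m z₀ ℓ, pm ≤ p z ∧ p z ≤ pp)
    (hlog : ∀ z ∈ cube m z₀ ℓ, ∀ w ∈ cube m z₀ ℓ, 0 < dist z w → dist z w < 1 / 2 →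
      |p z - p w| ≤ clog / (-Real.log (dist z w)))
    {z w : EuclideanSpace ℝ (Fin m)} (hz : z ∈ cube m z₀ ℓ) (hw : w ∈ cube m z₀ ℓ) :
    |p z - p w| * (-Real.log ℓ) ≤ 2 * clog + (pp - pm) * Real.log (4 * m ^ 2) := by
  have hm' : (1 : ℝ) ≤ m := by exact_mod_cast hm
  have hlog4 : 0 ≤ Real.log (4 * m ^ 2) := Real.log_nonneg (by nlinarith)
  have hℓlog : 0 ≤ -Real.log ℓ := by linarith [Real.log_nonpos hℓ.le hℓ1]
  have hrest : 0 ≤ (pp - pm) * Real.log (4 * m ^ 2) := mul_nonneg (by linarith) hlog4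
  rcases le_or_gt 1 (4 * m ^ 2 * ℓ) with h | h
  · have h1 : |p z - p w| ≤ pp - pm := by
      rw [abs_le]; constructor <;> linarith [hp z hz, hp w hw]
    have h2 : -Real.log ℓ ≤ Real.log (4 * m ^ 2) := by
      have := Real.log_nonneg h
      rw [Real.log_mul (by positivity) hℓ.ne'] at this
      linarith
    have := mul_le_mul h1 h2 hℓlog (by linarith)
    linarith
  · rcases (dist_nonneg (x := z) (y := w)).eq_or_lt with hd | hd
    · rw [dist_eq_zero.1 hd.symm]
      simp only [sub_self, abs_zero, zero_mul]
      linarith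
    · have hdm := dist_le_of_mem_cube hℓ.le hz hw
      have hsq : dist z w ^ 2 ≤ ℓ := by nlinarith
      have hd2 : dist z w < 1 / 2 := by nlinarith
      have hlogd : 2 * Real.log (dist z w) ≤ Real.log ℓ := by
        have := Real.log_le_log (by positivity) hsq
        rwa [Real.log_pow, Nat.cast_ofNat] at this
      have hneg : 0 < -Real.log (dist z w) := by
        linarith [Real.log_neg hd (by linarith)]
      have := hlog z hz w hw hd hd2
      rw [le_div_iff₀ hneg] at this
      nlinarith [abs_nonneg (p z - p w)]

/-! ### Changing the exponent -/

/-- A power `x ^ e` with `L⁻¹ ≤ x ≤ A L ^ k` is bounded in terms of `|e|` and `|e| log L`. -/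
theorem rpow_le_exp_of_mem {x e L A k D K : ℝ} (hL : 1 ≤ L) (hA : 1 ≤ A) (hk : 1 ≤ k)
    (hx : L⁻¹ ≤ x) (hxA : x ≤ A * L ^ k) (he : |e| ≤ D) (heK : |e| * Real.log L ≤ K) :
    x ^ e ≤ Real.exp (D * Real.log A + k * K) := by
  have hL0 : 0 < L := by linarith
  have hx0 : 0 < x := lt_of_lt_of_le (by positivity) hx
  have hlogL := Real.log_nonneg hL
  have hlogA := Real.log_nonneg hA
  have h1 : -Real.log L ≤ Real.log x := by
    rw [← Real.log_inv]; exact Real.log_le_log (by positivity) hx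
  have h2 : Real.log x ≤ Real.log A + k * Real.log L := by
    rw [← Real.log_rpow hL0, ← Real.log_mul (by positivity) (by positivity)]
    exact Real.log_le_log hx0 hxA
  have h3 : |Real.log x| ≤ Real.log A + k * Real.log L := by
    rw [abs_le]; constructor <;> nlinarith
  rw [Real.rpow_def_of_pos hx0]
  refine Real.exp_le_exp.2 ?_
  calc Real.log x * e ≤ |Real.log x * e| := le_abs_self _
    _ = |e| * |Real.log x| := by rw [abs_mul, mul_comm]
    _ ≤ |e| * (Real.log A + k * Real.log L) := by gcongr
    _ = |e| * Real.log A + k * (|e| * Real.log L) := by ring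
    _ ≤ D * Real.log A + k * K := by gcongr

/-- A point whose density is at most `2M` has size at most a power of `L`, if `a + M ≤ L`. -/
theorem add_le_mul_rpow {δ a p pm t M L : ℝ} (hδ : 0 ≤ δ) (ha : 0 ≤ a) (hpm : 1 < pm)
    (hp : pm ≤ p) (hL : 1 ≤ L) (hM : 0 ≤ M) (hML : a + M ≤ L) (ht : 0 < t)
    (h : (δ + a + t) ^ (p - 2) * t ≤ 2 * M) :
    δ + a + t ≤ (2 * δ + 2 + 4 ^ (1 / (pm - 1))) * L ^ (1 / (pm - 1) + 1) := by
  have hpm1 : 0 < pm - 1 := by linarith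
  have hL0 : 0 < L := by linarith
  have hk0 : 0 ≤ 1 / (pm - 1) := by positivity
  have h1 := add_le_of_shift_density_le (by positivity) (by linarith) ht h
  have h2 : (2 * (2 * M)) ^ (1 / (p - 1)) ≤ 4 ^ (1 / (pm - 1)) * L ^ (1 / (pm - 1)) := by
    rw [← Real.mul_rpow (by norm_num) hL0.le]
    calc (2 * (2 * M)) ^ (1 / (p - 1)) ≤ (4 * L) ^ (1 / (p - 1)) :=
          Real.rpow_le_rpow (by positivity) (by linarith)
            (one_div_nonneg.2 (by linarith))
      _ ≤ (4 * L) ^ (1 / (pm - 1)) :=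
          Real.rpow_le_rpow_of_exponent_le (by linarith)
            (one_div_le_one_div_of_le hpm1 (by linarith))
  have h3 : L ^ (1 / (pm - 1)) ≤ L ^ (1 / (pm - 1) + 1) :=
    Real.rpow_le_rpow_of_exponent_le hL (by linarith)
  have h4 : L ≤ L ^ (1 / (pm - 1) + 1) := by
    simpa using Real.rpow_le_rpow_of_exponent_le hL (by linarith : 1 ≤ 1 / (pm - 1) + 1)
  have h5 : (4 : ℝ) ^ (1 / (pm - 1)) * L ^ (1 / (pm - 1)) ≤
      4 ^ (1 / (pm - 1)) * L ^ (1 / (pm - 1) + 1) := by gcongr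
  nlinarith

/-- Comparison of `(φ_{p'})_a` at a small multiple of `t` with the density of `(φ_p)_a`. -/
theorem phiShift_mul_le_of_osc {δ a p p' pm t M L B q l : ℝ} (hδ : 0 ≤ δ) (ha : 0 ≤ a)
    (hp' : pm ≤ p') (hpm : 1 < pm) (hq1 : 1 < q) (hq2 : q ≤ 2) (hqp : q ≤ pm) (hL : 1 ≤ L)
    (hM : 0 ≤ M) (ht : 0 < t) (hl : 0 < l) (hl1 : l ≤ 1) (hlB : l ^ (q - 1) * (4 * B) ≤ 1)
    (h : (δ + a + t) ^ (p - 2) * t ≤ 2 * M)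
    (hB : L⁻¹ ≤ δ + a + t → (δ + a + t) ^ (p' - p) ≤ B) :
    phiShift δ p' a (l * t) ≤ l / 2 * (t * M) + L⁻¹ := by
  have hb : 0 ≤ δ + a := by positivity
  have hbt : 0 < δ + a + t := by linarith
  have hL0 : 0 < L := by linarith
  refine (phiShift_mul_le hb (by linarith) hq2 (hqp.trans hp') hl hl1 ht).trans ?_
  rcases le_or_gt L⁻¹ (δ + a + t) with hx | hx
  · have hB0 := hB hx
    have hsplit : (δ + a + t) ^ (p' - 2) = (δ + a + t) ^ (p - 2) * (δ + a + t) ^ (p' - p) := by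
      rw [← Real.rpow_add hbt]; ring_nf
    have hlq : l ^ q = l * l ^ (q - 1) := by
      rw [Real.rpow_sub_one hl.ne']; field_simp
    have : l ^ q * (t ^ 2 * (δ + a + t) ^ (p' - 2)) ≤ l / 2 * (t * M) := by
      calc l ^ q * (t ^ 2 * (δ + a + t) ^ (p' - 2))
          = l * t * l ^ (q - 1) *
            (((δ + a + t) ^ (p - 2) * t) * (δ + a + t) ^ (p' - p)) := by
            rw [hsplit, hlq]; ring
        _ ≤ l * t * l ^ (q - 1) * (2 * M * B) := by gcongr
        _ = l / 2 * (t * M) * (l ^ (q - 1) * (4 * B)) := by ring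
        _ ≤ l / 2 * (t * M) * 1 := by gcongr
        _ = _ := mul_one _
    have : 0 ≤ L⁻¹ := by positivity
    linarith
  · have hlq : l ^ q ≤ 1 := Real.rpow_le_one hl.le hl1 (by linarith)
    have hx1 : δ + a + t ≤ 1 := hx.le.trans (inv_le_one_of_one_le₀ hL)
    have : l ^ q * (t ^ 2 * (δ + a + t) ^ (p' - 2)) ≤ L⁻¹ := by
      calc l ^ q * (t ^ 2 * (δ + a + t) ^ (p' - 2))
          ≤ 1 * ((δ + a + t) ^ 2 * (δ + a + t) ^ (p' - 2)) := by gcongr; linarith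
        _ = (δ + a + t) ^ p' := by
            rw [one_mul, ← Real.rpow_two, ← Real.rpow_add hbt]; ring_nf
        _ ≤ (δ + a + t) ^ (1 : ℝ) :=
            Real.rpow_le_rpow_of_exponent_ge hbt hx1 (by linarith)
        _ ≤ L⁻¹ := by rw [Real.rpow_one]; exact hx.le
    have : 0 ≤ l / 2 * (t * M) := by positivity
    linarith

/-! ### The key estimate -/

theorem integrableOn_fconj_phiShift {α : Type*} [MeasurableSpace α] {μ : Measure α} {s : Set α}
    (hs : MeasurableSet s) {δ a pm : ℝ} (hb : 0 ≤ δ + a) (hpm : 1 < pm) {p f : α → ℝ}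
    (hp : Measurable p) (hpm_le : ∀ w ∈ s, pm ≤ p w) (hf : IntegrableOn f s μ)
    (hfp : (∫⁻ w in s, ENNReal.ofReal (|f w| ^ (p w / (p w - 1))) ∂μ) < ⊤) :
    IntegrableOn (fun w => fconj (phiShift δ (p w) a) |f w|) s μ := by
  have habs : AEMeasurable (fun w => |f w|) (μ.restrict s) :=
    hf.aestronglyMeasurable.aemeasurable.abs
  have hmeas : AEStronglyMeasurable (fun w => fconj (phiShift δ (p w) a) |f w|)
      (μ.restrict s) := by
    have h1 : Measurable fun x : ℝ × ℝ =>
        ⨆ q : ℚ≥0, (x.2 * (q : ℝ) - phiShift δ x.1 a q) :=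
      Measurable.iSup fun q => (measurable_snd.mul_const _).sub
        ((measurable_phiShift δ a q.cast_nonneg).comp measurable_fst)
    refine (h1.comp_aemeasurable (hp.aemeasurable.prodMk habs)).aestronglyMeasurable.congr ?_
    filter_upwards [ae_restrict_mem hs] with w hw
    exact (fconj_phiShift_eq_iSup_nnrat hb (hpm.trans_le (hpm_le w hw)) (abs_nonneg _)).symm
  have hpow : Integrable (fun w => |f w| ^ (p w / (p w - 1))) (μ.restrict s) :=
    (lintegral_ofReal_ne_top_iff_integrable
      (habs.pow (hp.div (hp.sub_const 1)).aemeasurable).aestronglyMeasurable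
      (Filter.Eventually.of_forall fun w => by positivity)).1 hfp.ne
  refine ((hf.abs.const_mul (4 * (δ + a))).add
    (hpow.const_mul (2 * 4 ^ (1 / (pm - 1))))).mono' hmeas ?_
  filter_upwards [ae_restrict_mem hs] with w hw
  have hpw := hpm_le w hw
  rw [Real.norm_of_nonneg (fconj_phiShift_nonneg hb (hpm.trans_le hpw) (abs_nonneg _))]
  exact fconj_phiShift_le hb (hpm.trans_le hpw) (abs_nonneg _)
    (one_div_le_one_div_of_le (by linarith) (by linarith))

/-- Jensen-type estimate on averages, from a uniform affine lower bound. -/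
theorem mul_setAverage_sub_le_setAverage {α : Type*} [MeasurableSpace α] {μ : Measure α}
    {s : Set α} (hs : MeasurableSet s) (hs0 : μ s ≠ 0) (hs1 : μ s ≠ ⊤) {f g : α → ℝ}
    (hf : IntegrableOn f s μ) (hg : IntegrableOn g s μ) {u v : ℝ}
    (h : ∀ w ∈ s, u * f w - v ≤ g w) :
    u * (⨍ w in s, f w ∂μ) - v ≤ ⨍ w in s, g w ∂μ := by
  have hμ : 0 < μ.real s := ENNReal.toReal_pos hs0 hs1
  have hc : IntegrableOn (fun _ => v) s μ := integrableOn_const hs1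
  have h1 : ∫ w in s, (u * f w - v) ∂μ ≤ ∫ w in s, g w ∂μ :=
    setIntegral_mono_on ((hf.const_mul u).sub hc) hg hs h
  rw [integral_sub (hf.const_mul u) hc, integral_const_mul, setIntegral_const,
    smul_eq_mul] at h1
  rw [setAverage_eq, setAverage_eq, smul_eq_mul, smul_eq_mul]
  calc u * ((μ.real s)⁻¹ * ∫ w in s, f w ∂μ) - v
      = (μ.real s)⁻¹ * (u * ∫ w in s, f w ∂μ - μ.real s * v) := by field_simp
    _ ≤ _ := by gcongr

theorem stmt12 (m : ℕ) (hm : 1 ≤ m) (δ pm pp clog : ℝ)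
    (hδ : 0 ≤ δ) (hpm : 1 < pm) (hpmpp : pm ≤ pp) (hclog : 0 ≤ clog) :
    ∀ n : ℝ, 0 < n → ∃ c : ℝ, 0 < c ∧
      ∀ (z₀ : EuclideanSpace ℝ (Fin m)) (ℓ : ℝ), 0 < ℓ → ℓ ≤ 1 →
      ∀ p : EuclideanSpace ℝ (Fin m) → ℝ, Measurable p →
      (∀ z ∈ cube m z₀ ℓ, pm ≤ p z ∧ p z ≤ pp) →
      (∀ z ∈ cube m z₀ ℓ, ∀ w ∈ cube m z₀ ℓ, 0 < dist z w → dist z w < 1 / 2 →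
        |p z - p w| ≤ clog / (-Real.log (dist z w))) →
      ∀ a : ℝ, 0 ≤ a →
      ∀ f : EuclideanSpace ℝ (Fin m) → ℝ,
      IntegrableOn f (cube m z₀ ℓ) volume →
      (∫⁻ w in cube m z₀ ℓ, ENNReal.ofReal (|f w| ^ (p w / (p w - 1))) ∂volume) < ⊤ →
      a + ⨍ w in cube m z₀ ℓ, |f w| ∂volume ≤ (volume (cube m z₀ ℓ)).toReal ^ (-n) →
      ∀ᵐ z ∂(volume.restrict (cube m z₀ ℓ)),
        fconj (phiShift δ (p z) a) (⨍ w in cube m z₀ ℓ, |f w| ∂volume) ≤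
          c * ((⨍ w in cube m z₀ ℓ, fconj (phiShift δ (p w) a) (|f w|) ∂volume) +
            (volume (cube m z₀ ℓ)).toReal ^ n) := by
  intro n hn
  have hm' : (1 : ℝ) ≤ m := by exact_mod_cast hm
  have hpm1 : 0 < pm - 1 := by linarith
  set A : ℝ := 2 * δ + 2 + 4 ^ (1 / (pm - 1)) with hA
  set k : ℝ := 1 / (pm - 1) + 1 with hk
  set K : ℝ := m * n * (2 * clog + (pp - pm) * Real.log (4 * m ^ 2)) with hK
  set B : ℝ := Real.exp ((pp - pm) * Real.log A + k * K) with hB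
  set q : ℝ := min 2 pm with hq
  have hA1 : 1 ≤ A := by
    have : (0 : ℝ) < 4 ^ (1 / (pm - 1)) := by positivity
    linarith
  have hk1 : 1 ≤ k := by
    have : 0 < 1 / (pm - 1) := by positivity
    linarith
  have hK0 : 0 ≤ K := by
    have h1 : 0 ≤ Real.log (4 * m ^ 2) := Real.log_nonneg (by nlinarith)
    have h2 : 0 ≤ pp - pm := by linarith
    positivity
  have hB1 : 1 ≤ B := Real.one_le_exp (by
    have h1 := Real.log_nonneg hA1
    have h2 : 0 ≤ pp - pm := by linarith
    positivity)
  have hq1 : 1 < q := lt_min one_lt_two hpm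
  set l : ℝ := (1 / (4 * B)) ^ (1 / (q - 1)) with hl
  have hl0 : 0 < l := by positivity
  have hl1 : l ≤ 1 := Real.rpow_le_one (by positivity)
    ((div_le_one (by positivity)).2 (by linarith)) (one_div_nonneg.2 (by linarith))
  have hlB : l ^ (q - 1) * (4 * B) ≤ 1 := by
    rw [hl, ← Real.rpow_mul (by positivity), one_div_mul_cancel (by linarith), Real.rpow_one,
      one_div_mul_cancel (by positivity)]
  refine ⟨4 / l, by positivity, fun z₀ ℓ hℓ hℓ1 p hp hpb hlog a ha f hf hfp hsmall => ?_⟩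
  set Q := cube m z₀ ℓ with hQ
  have hQm : MeasurableSet Q := measurableSet_cube m z₀ ℓ
  have hQvol : volume Q = ENNReal.ofReal ℓ ^ m := volume_cube m z₀ ℓ
  have hQ0 : volume Q ≠ 0 := by
    rw [hQvol]; exact pow_ne_zero _ (ENNReal.ofReal_pos.2 hℓ).ne'
  have hQtop : volume Q ≠ ⊤ := by
    rw [hQvol]; exact ENNReal.pow_ne_top ENNReal.ofReal_ne_top
  have hV : (volume Q).toReal = ℓ ^ m := by
    rw [hQvol, ENNReal.toReal_pow, ENNReal.toReal_ofReal hℓ.le]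
  set V := (volume Q).toReal
  have hV0 : 0 < V := by rw [hV]; positivity
  have hV1 : V ≤ 1 := by rw [hV]; exact pow_le_one₀ hℓ.le hℓ1
  set L : ℝ := V ^ (-n) with hL
  have hL1 : 1 ≤ L := Real.one_le_rpow_of_pos_of_le_one_of_nonpos hV0 hV1 (by linarith)
  have hLinv : L⁻¹ = V ^ n := by rw [hL, Real.rpow_neg hV0.le, inv_inv]
  have hlogL : Real.log L = m * n * -Real.log ℓ := by
    rw [hL, Real.log_rpow hV0, hV, Real.log_pow]; ring
  have hb : 0 ≤ δ + a := by positivity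
  set M := ⨍ w in Q, |f w| ∂volume
  have hM : 0 ≤ M := by
    simp only [M, setAverage_eq, smul_eq_mul]
    exact mul_nonneg (by positivity) (integral_nonneg fun _ => abs_nonneg _)
  have hG := integrableOn_fconj_phiShift hQm hb hpm hp (fun w hw => (hpb w hw).1) hf hfp
  set G := ⨍ w in Q, fconj (phiShift δ (p w) a) |f w| ∂volume
  have hG0 : 0 ≤ G := by
    simp only [G, setAverage_eq, smul_eq_mul]
    exact mul_nonneg (by positivity) (setIntegral_nonneg hQm fun w hw =>
      fconj_phiShift_nonneg hb (hpm.trans_le (hpb w hw).1) (abs_nonneg _))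
  filter_upwards [ae_restrict_mem hQm] with z hz
  refine ciSup_le fun s => mul_sub_phiShift_le hb (hpm.trans_le (hpb z hz).1)
    (by positivity) (fun t ht h => ?_) s.2
  have hlower : ∀ w ∈ Q,
      l * t * |f w| - (l / 2 * (t * M) + L⁻¹) ≤ fconj (phiShift δ (p w) a) |f w| := by
    intro w hw
    have hpw := (hpb w hw).1
    have h1 := mul_sub_phiShift_le_fconj hb (hpm.trans_le hpw) (abs_nonneg (f w))
      (mul_pos hl0 ht).le
    have h2 : phiShift δ (p w) a (l * t) ≤ l / 2 * (t * M) + L⁻¹ := by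
      refine phiShift_mul_le_of_osc hδ ha hpw hpm hq1 (min_le_left _ _) (min_le_right _ _)
        hL1 hM ht hl0 hl1 hlB h fun hx => ?_
      refine rpow_le_exp_of_mem hL1 hA1 hk1 hx
        (add_le_mul_rpow hδ ha hpm (hpb z hz).1 hL1 hM hsmall ht h) ?_ ?_
      · rw [abs_le]; constructor <;> linarith [hpb z hz, hpb w hw]
      · have := osc_mul_neg_log_le hm hpmpp hclog hℓ hℓ1 hpb hlog hw hz
        rw [hlogL, hK, mul_left_comm]
        gcongr
    linarith
  have hmain := mul_setAverage_sub_le_setAverage hQm hQ0 hQtop hf.abs hG hlower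
  change l * t * M - (l / 2 * (t * M) + L⁻¹) ≤ G at hmain
  rw [hLinv] at hmain
  rw [div_mul_eq_mul_div, le_div_iff₀ hl0]
  linarith
end
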